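/- arXiv:1211.1001 — 2 statements merged into one kernel-verified Lean document; each statement's English description precedes it below -/
import Mathlib

section
/- (First partial derivative of J_ρ) For every ρ ∈ (−1,1) and every (x,y) ∈ (0,1)², ∂J_ρ(x,y)/∂x = Φ((Φ⁻¹(y) − ρ·Φ⁻¹(x))/√(1−ρ²)), where Φ is the standard normal CDF. -/
open MeasureTheory

noncomputable section
namespace DMN

/-- The standard normal CDF `Φ`. -/
def Phi (t : ℝ) : ℝ := ∫ s in Set.Iic t, Real.exp (-s ^ 2 / 2) / Real.sqrt (2 * Real.pi)

/-- The inverse of the standard normal CDF. -/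
def PhiInv : ℝ → ℝ := Function.invFun Phi

/-- `J_ρ(x,y) = P[X ≤ Φ⁻¹(x), Y ≤ Φ⁻¹(y)]` for a centered bivariate Gaussian `(X,Y)`
with unit variances and covariance `ρ`, extended continuously to the boundary of
`[0,1]²`. -/
def J (ρ x y : ℝ) : ℝ :=
  if x = 0 ∨ y = 0 then 0
  else if x = 1 then y
  else if y = 1 then x
  else
    ∫ s in Set.Iic (PhiInv x), ∫ t in Set.Iic (PhiInv y),
      Real.exp (-(s ^ 2 - 2 * ρ * s * t + t ^ 2) / (2 * (1 - ρ ^ 2))) /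
        (2 * Real.pi * Real.sqrt (1 - ρ ^ 2))

/-- Partial derivative in the first variable. -/
def pdx (F : ℝ → ℝ → ℝ) : ℝ → ℝ → ℝ := fun x y => deriv (fun x' => F x' y) x

/-- Partial derivative in the second variable. -/
def pdy (F : ℝ → ℝ → ℝ) : ℝ → ℝ → ℝ := fun x y => deriv (fun y' => F x y') y

theorem gaussianPDFReal_zero_one (s : ℝ) :
    ProbabilityTheory.gaussianPDFReal 0 1 s = Real.exp (-s ^ 2 / 2) / Real.sqrt (2 * Real.pi) := by
  simp [ProbabilityTheory.gaussianPDFReal, div_eq_inv_mul]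

theorem continuous_gaussian_density :
    Continuous fun s : ℝ => Real.exp (-s ^ 2 / 2) / Real.sqrt (2 * Real.pi) := by
  fun_prop

theorem integrable_gaussian_density :
    Integrable fun s : ℝ => Real.exp (-s ^ 2 / 2) / Real.sqrt (2 * Real.pi) := by
  simpa only [← gaussianPDFReal_zero_one] using
    ProbabilityTheory.integrable_gaussianPDFReal 0 1

theorem Phi_eq_cdf (t : ℝ) :
    Phi t = ProbabilityTheory.cdf (ProbabilityTheory.gaussianReal 0 1) t := by
  rw [ProbabilityTheory.cdf_eq_real, measureReal_def,
    ProbabilityTheory.gaussianReal_apply_eq_integral 0 one_ne_zero, ENNReal.toReal_ofReal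
      (integral_nonneg fun s => ProbabilityTheory.gaussianPDFReal_nonneg 0 1 s)]
  simp only [gaussianPDFReal_zero_one, Phi]

theorem Phi_nonneg (t : ℝ) : 0 ≤ Phi t := by
  rw [Phi_eq_cdf]
  exact ProbabilityTheory.cdf_nonneg _ t

theorem Phi_le_one (t : ℝ) : Phi t ≤ 1 := by
  rw [Phi_eq_cdf]
  exact ProbabilityTheory.cdf_le_one _ t

/-- The fundamental theorem of calculus on a left half-line. -/
theorem hasStrictDerivAt_integral_Iic {f : ℝ → ℝ} (hf : Continuous f) (hi : Integrable f)
    (a : ℝ) : HasStrictDerivAt (fun u => ∫ s in Set.Iic u, f s) (f a) a := by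
  have h : (fun u => ∫ s in Set.Iic u, f s) =
      fun u => (∫ s in Set.Iic (0 : ℝ), f s) + ∫ s in (0 : ℝ)..u, f s := by
    funext u
    rw [← intervalIntegral.integral_Iic_sub_Iic hi.integrableOn hi.integrableOn]
    ring
  rw [h]
  exact (hf.integral_hasStrictDerivAt 0 a).const_add _

theorem hasStrictDerivAt_Phi (t : ℝ) :
    HasStrictDerivAt Phi (Real.exp (-t ^ 2 / 2) / Real.sqrt (2 * Real.pi)) t :=
  hasStrictDerivAt_integral_Iic continuous_gaussian_density integrable_gaussian_density t

theorem continuous_Phi : Continuous Phi :=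
  continuous_iff_continuousAt.2 fun t => (hasStrictDerivAt_Phi t).hasDerivAt.continuousAt

theorem strictMono_Phi : StrictMono Phi :=
  strictMono_of_deriv_pos fun t => by
    rw [(hasStrictDerivAt_Phi t).hasDerivAt.deriv]
    positivity

theorem Phi_PhiInv {x : ℝ} (hx : x ∈ Set.Ioo (0 : ℝ) 1) : Phi (PhiInv x) = x := by
  have h0 := ProbabilityTheory.tendsto_cdf_atBot (ProbabilityTheory.gaussianReal 0 1)
  have h1 := ProbabilityTheory.tendsto_cdf_atTop (ProbabilityTheory.gaussianReal 0 1)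
  obtain ⟨a, ha⟩ := (h0.eventually_lt_const hx.1).exists
  obtain ⟨b, hb⟩ := (h1.eventually_const_lt hx.2).exists
  rw [← Phi_eq_cdf] at ha hb
  exact Function.invFun_eq
    (mem_range_of_exists_le_of_exists_ge continuous_Phi ⟨a, ha.le⟩ ⟨b, hb.le⟩)

theorem hasDerivAt_PhiInv {x : ℝ} (hx : x ∈ Set.Ioo (0 : ℝ) 1) :
    HasDerivAt PhiInv (Real.exp (-PhiInv x ^ 2 / 2) / Real.sqrt (2 * Real.pi))⁻¹ x := by
  have h := (hasStrictDerivAt_Phi (PhiInv x)).to_local_left_inverse (by positivity)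
    (.of_forall (Function.leftInverse_invFun strictMono_Phi.injective))
  rw [Phi_PhiInv hx] at h
  exact h.hasDerivAt

theorem integral_Iic_comp_sub_div (f : ℝ → ℝ) (b m : ℝ) {r : ℝ} (hr : 0 < r) :
    ∫ t in Set.Iic b, f ((t - m) / r) = r * ∫ t in Set.Iic ((b - m) / r), f t := by
  rw [← integral_indicator measurableSet_Iic, ← integral_indicator measurableSet_Iic]
  have h : (Set.Iic b).indicator (fun t => f ((t - m) / r)) =
      fun t => (Set.Iic ((b - m) / r)).indicator f ((t - m) / r) := by
    funext t
    simp only [Set.indicator_apply, Set.mem_Iic, div_le_div_iff_of_pos_right hr,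
      sub_le_sub_iff_right]
  rw [h, integral_sub_right_eq_self (fun t => (Set.Iic ((b - m) / r)).indicator f (t / r)) m,
    Measure.integral_comp_div, abs_of_pos hr, smul_eq_mul]

/-- Integrating the bivariate Gaussian density in the second variable gives the first marginal
density times the conditional distribution function. -/
theorem integral_bivariate_density {ρ : ℝ} (hρ : 0 < 1 - ρ ^ 2) (b s : ℝ) :
    ∫ t in Set.Iic b, Real.exp (-(s ^ 2 - 2 * ρ * s * t + t ^ 2) / (2 * (1 - ρ ^ 2))) /
        (2 * Real.pi * Real.sqrt (1 - ρ ^ 2)) =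
      Real.exp (-s ^ 2 / 2) / Real.sqrt (2 * Real.pi) *
        Phi ((b - ρ * s) / Real.sqrt (1 - ρ ^ 2)) := by
  have hr := Real.sqrt_pos.2 hρ
  have hr2 := Real.sq_sqrt hρ.le
  have hp : Real.sqrt (2 * Real.pi) ^ 2 = 2 * Real.pi := Real.sq_sqrt (by positivity)
  have hp0 : 0 < Real.sqrt (2 * Real.pi) := by positivity
  set r := Real.sqrt (1 - ρ ^ 2)
  have key (t : ℝ) : Real.exp (-(s ^ 2 - 2 * ρ * s * t + t ^ 2) / (2 * (1 - ρ ^ 2))) /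
        (2 * Real.pi * r) = Real.exp (-s ^ 2 / 2) / Real.sqrt (2 * Real.pi) / r *
        (Real.exp (-((t - ρ * s) / r) ^ 2 / 2) / Real.sqrt (2 * Real.pi)) := by
    have he : -(s ^ 2 - 2 * ρ * s * t + t ^ 2) / (2 * (1 - ρ ^ 2)) =
        -s ^ 2 / 2 + -((t - ρ * s) / r) ^ 2 / 2 := by
      rw [div_pow, hr2]
      field_simp
      ring
    rw [he, Real.exp_add]
    field_simp
    exact hp
  simp_rw [key]
  rw [integral_const_mul, integral_Iic_comp_sub_div
    (fun u => Real.exp (-u ^ 2 / 2) / Real.sqrt (2 * Real.pi)) b (ρ * s) hr, ← Phi]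
  field_simp

theorem hasDerivAt_integral_density_mul_Phi (ρ b r a : ℝ) :
    HasDerivAt (fun u => ∫ s in Set.Iic u,
        Real.exp (-s ^ 2 / 2) / Real.sqrt (2 * Real.pi) * Phi ((b - ρ * s) / r))
      (Real.exp (-a ^ 2 / 2) / Real.sqrt (2 * Real.pi) * Phi ((b - ρ * a) / r)) a := by
  have hc : Continuous fun s : ℝ => Phi ((b - ρ * s) / r) :=
    continuous_Phi.comp (by fun_prop)
  refine (hasStrictDerivAt_integral_Iic (continuous_gaussian_density.mul hc)
    (integrable_gaussian_density.mul_bdd (c := 1) hc.aestronglyMeasurable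
      (.of_forall fun s => ?_)) a).hasDerivAt
  rw [Real.norm_of_nonneg (Phi_nonneg _)]
  exact Phi_le_one _

/-- **First partial derivative of `J_ρ`**:
`∂J_ρ(x,y)/∂x = Φ((Φ⁻¹(y) - ρ Φ⁻¹(x)) / √(1-ρ²))`. -/
theorem pdx_J (ρ : ℝ) (hρ0 : -1 < ρ) (hρ1 : ρ < 1) (x y : ℝ)
    (hx : x ∈ Set.Ioo (0 : ℝ) 1) (hy : y ∈ Set.Ioo (0 : ℝ) 1) :
    pdx (J ρ) x y = Phi ((PhiInv y - ρ * PhiInv x) / Real.sqrt (1 - ρ ^ 2)) := by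
  have hρ : 0 < 1 - ρ ^ 2 := by nlinarith
  have hJ : (fun x' => J ρ x' y) =ᶠ[nhds x] (fun u => ∫ s in Set.Iic u,
      Real.exp (-s ^ 2 / 2) / Real.sqrt (2 * Real.pi) *
        Phi ((PhiInv y - ρ * s) / Real.sqrt (1 - ρ ^ 2))) ∘ PhiInv := by
    filter_upwards [isOpen_Ioo.mem_nhds hx] with x' hx'
    simp only [J, hx'.1.ne', hy.1.ne', hx'.2.ne, hy.2.ne, or_self, if_false,
      integral_bivariate_density hρ, Function.comp_apply]
  have h := ((hasDerivAt_integral_density_mul_Phi ρ (PhiInv y) (Real.sqrt (1 - ρ ^ 2))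
    (PhiInv x)).comp x (hasDerivAt_PhiInv hx)).congr_of_eventuallyEq hJ
  rw [pdx, h.deriv, mul_right_comm, mul_inv_cancel₀ (by positivity), one_mul]

end DMN
end
end

section
/- (SoS version of Majority is Stablest, Theorem 6.1) For every κ > 0 and every ρ ∈ (−1,0), there exist d₀ = d₀(κ,ρ), d₁ = d₁(κ,ρ) ∈ ℕ and c = c(κ,ρ) > 0, depending only on κ and ρ (not on n), such that for every n the following holds. In the polynomial ring over ℝ with one indeterminate f(x) for each x ∈ {−1,1}ⁿ, let A_p be the constraint set {f(x) ≥ 0 and 1 − f(x) ≥ 0 : x ∈ {−1,1}ⁿ}. Then there is a degree-d₀ SoS proof from A_p of the inequality E_{x, y∼_ρ x}[f(x)·f(y) + (1−f(x))·(1−f(y))] ≥ 1 − (arccos ρ)/π − κ − c·Σ_{i=1}^{n} (Inf_i^{≤d₁}(f))², where both sides are polynomials in the indeterminates f(x). -/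
open MvPolynomial

noncomputable section
namespace DMN

/-- The real sign of a boolean bit: `true ↦ 1`, `false ↦ -1`. -/
def sgn (b : Bool) : ℝ := if b then 1 else -1

/-- The character `χ_S(x) = ∏_{i ∈ S} x_i` on the discrete cube. -/
def chi {n : ℕ} (S : Finset (Fin n)) (x : Fin n → Bool) : ℝ := ∏ i ∈ S, sgn (x i)

/-- The probability weight of `(x, y)` under the uniformly `ρ`-correlated distribution
on `{-1,1}^n × {-1,1}^n` (independent coordinate pairs with uniform marginals and
`E[x_i y_i] = ρ`). -/
def corrWeight {n : ℕ} (ρ : ℝ) (x y : Fin n → Bool) : ℝ :=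
  ∏ i, (1 + ρ * sgn (x i) * sgn (y i)) / 4

/-- A polynomial is a sum of squares. -/
def IsSOS {σ : Type*} (p : MvPolynomial σ ℝ) : Prop :=
  ∃ (k : ℕ) (s : Fin k → MvPolynomial σ ℝ), p = ∑ i, s i ^ 2

/-- A degree-`d` SoS proof from the constraint set `A` of the inequality `h ≥ 0`:
an identity `h = Σ r_q · q` where each `q` is a finite product of constraint
polynomials (including the empty product `1`), each `r_q` is a sum of squares, and
`deg(r_q) + deg(q) ≤ d` for every term. -/
def SosProofGe {σ : Type*} (A : Set (MvPolynomial σ ℝ)) (d : ℕ)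
    (h : MvPolynomial σ ℝ) : Prop :=
  ∃ (k : ℕ) (q r : Fin k → MvPolynomial σ ℝ),
    (∀ i, ∃ m : Multiset (MvPolynomial σ ℝ), (∀ a ∈ m, a ∈ A) ∧ q i = m.prod) ∧
    (∀ i, IsSOS (r i)) ∧
    (∀ i, (r i).totalDegree + (q i).totalDegree ≤ d) ∧
    h = ∑ i, r i * q i

/-- The Fourier coefficient `f̂(S) = E_x[f(x) χ_S(x)]` as a linear form in the
indeterminates `f(x)`, `x ∈ {-1,1}^n`. -/
def fhatP {n : ℕ} (S : Finset (Fin n)) : MvPolynomial (Fin n → Bool) ℝ :=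
  C (((2 : ℝ) ^ n)⁻¹) * ∑ x, C (chi S x) * X x

/-- The degree-`d₁` low-degree influence `Inf_i^{≤d₁}(f) = Σ_{S ∋ i, |S| ≤ d₁} f̂(S)²`
as a quadratic polynomial in the indeterminates `f(x)`. -/
def lowInfP {n : ℕ} (d₁ : ℕ) (i : Fin n) : MvPolynomial (Fin n → Bool) ℝ :=
  ∑ S ∈ Finset.univ.powerset.filter (fun S => i ∈ S ∧ S.card ≤ d₁), fhatP S ^ 2

/-- `E_{x, y ∼_ρ x}[f(x) f(y) + (1 - f(x))(1 - f(y))]` as a quadratic polynomial in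
the indeterminates `f(x)`. -/
def stabP {n : ℕ} (ρ : ℝ) : MvPolynomial (Fin n → Bool) ℝ :=
  ∑ x, ∑ y, C (corrWeight ρ x y) * (X x * X y + (1 - X x) * (1 - X y))

/-- The constraint set `A_p = {f(x) ≥ 0, 1 - f(x) ≥ 0 : x ∈ {-1,1}^n}`, recorded as
the set of its constraint polynomials. -/
def cubeConstraints (n : ℕ) : Set (MvPolynomial (Fin n → Bool) ℝ) :=
  {p | ∃ x : Fin n → Bool, p = X x ∨ p = 1 - X x}

/-! ### The Gaussian profile -/

/-- The standard Gaussian density. -/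
def gpdf (u : ℝ) : ℝ := Real.exp (-u ^ 2 / 2) / √(2 * Real.pi)

/-- The standard Gaussian distribution function. -/
def gcdf (s : ℝ) : ℝ := 1 / 2 + ∫ u in (0 : ℝ)..s, gpdf u

lemma gpdf_pos (u : ℝ) : 0 < gpdf u := by unfold gpdf; positivity

lemma continuous_gpdf : Continuous gpdf := by unfold gpdf; fun_prop

lemma hasDerivAt_gpdf (u : ℝ) : HasDerivAt gpdf (-u * gpdf u) u := by
  have h : HasDerivAt (fun u : ℝ => -u ^ 2 / 2) (-u) u :=
    (((hasDerivAt_id u).pow 2).neg.div_const 2).congr_deriv (by simp; ring)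
  refine ((h.exp).div_const (√(2 * Real.pi))).congr_deriv ?_
  unfold gpdf
  ring

lemma hasDerivAt_gcdf (s : ℝ) : HasDerivAt gcdf (gpdf s) s :=
  (intervalIntegral.integral_hasDerivAt_right (continuous_gpdf.intervalIntegrable _ _)
    (continuous_gpdf.stronglyMeasurableAtFilter _ _) continuous_gpdf.continuousAt).const_add (1 / 2)

lemma continuous_gcdf : Continuous gcdf :=
  continuous_iff_continuousAt.2 fun s => (hasDerivAt_gcdf s).continuousAt

lemma strictMono_gcdf : StrictMono gcdf :=
  strictMono_of_hasDerivAt_pos hasDerivAt_gcdf gpdf_pos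

lemma gcdf_neg (s : ℝ) : gcdf (-s) = 1 - gcdf s := by
  have h : ∫ u in (0 : ℝ)..s, gpdf u = ∫ u in (-s)..0, gpdf u := by
    rw [← neg_zero, ← intervalIntegral.integral_comp_neg]
    simp [gpdf]
  unfold gcdf
  rw [h, intervalIntegral.integral_symm]
  ring

lemma tendsto_gcdf_atTop : Filter.Tendsto gcdf Filter.atTop (nhds 1) := by
  have hg : ∀ u, gpdf u = Real.exp (-(1 / 2) * u ^ 2) / √(2 * Real.pi) := fun u => by
    unfold gpdf; congr 2; ring
  have hi : MeasureTheory.Integrable gpdf := by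
    rw [funext hg]
    exact (integrable_exp_neg_mul_sq (by norm_num)).div_const _
  have h := MeasureTheory.intervalIntegral_tendsto_integral_Ioi (0 : ℝ) hi.integrableOn
    Filter.tendsto_id
  have hval : ∫ u in Set.Ioi (0 : ℝ), gpdf u = 1 / 2 := by
    simp_rw [hg]
    rw [MeasureTheory.integral_div, integral_gaussian_Ioi,
      show Real.pi / (1 / 2) = 2 * Real.pi by ring]
    field_simp
  rw [hval] at h
  have h2 := h.const_add (1 / 2)
  rw [add_halves] at h2
  exact h2

lemma tendsto_gcdf_atBot : Filter.Tendsto gcdf Filter.atBot (nhds 0) := by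
  have h := (tendsto_gcdf_atTop.comp Filter.tendsto_neg_atBot_atTop).const_sub 1
  simpa [Function.comp_def, gcdf_neg] using h

lemma gcdf_lt_one (s : ℝ) : gcdf s < 1 :=
  lt_of_lt_of_le (strictMono_gcdf (lt_add_one s))
    (strictMono_gcdf.monotone.ge_of_tendsto tendsto_gcdf_atTop _)

lemma gcdf_pos (s : ℝ) : 0 < gcdf s := by
  have := gcdf_lt_one (-s)
  rw [gcdf_neg] at this
  linarith

lemma exists_gcdf_eq {x : ℝ} (h0 : 0 < x) (h1 : x < 1) : ∃ s, gcdf s = x :=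
  mem_range_of_exists_le_of_exists_ge continuous_gcdf
    ((tendsto_gcdf_atBot.eventually_le_const h0).exists)
    ((tendsto_gcdf_atTop.eventually_const_le h1).exists)

/-- The Gaussian quantile function. -/
def gquant : ℝ → ℝ := Function.invFun gcdf

lemma gquant_gcdf (s : ℝ) : gquant (gcdf s) = s :=
  Function.leftInverse_invFun strictMono_gcdf.injective s

lemma gcdf_gquant {x : ℝ} (hx : x ∈ Set.Ioo (0 : ℝ) 1) : gcdf (gquant x) = x :=
  Function.invFun_eq (exists_gcdf_eq hx.1 hx.2)

lemma continuousAt_gquant {x : ℝ} (hx : x ∈ Set.Ioo (0 : ℝ) 1) : ContinuousAt gquant x := by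
  have hm : StrictMonoOn gquant (Set.Ioo 0 1) := fun y hy z hz hyz => by
    rw [← strictMono_gcdf.lt_iff_lt, gcdf_gquant hy, gcdf_gquant hz]
    exact hyz
  refine hm.continuousAt_of_image_mem_nhds (isOpen_Ioo.mem_nhds hx) ?_
  have : gquant '' Set.Ioo 0 1 = Set.univ :=
    Set.eq_univ_of_forall fun s => ⟨gcdf s, ⟨gcdf_pos s, gcdf_lt_one s⟩, gquant_gcdf s⟩
  rw [this]
  exact Filter.univ_mem

lemma hasDerivAt_gquant {x : ℝ} (hx : x ∈ Set.Ioo (0 : ℝ) 1) :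
    HasDerivAt gquant (gpdf (gquant x))⁻¹ x :=
  HasDerivAt.of_local_left_inverse (continuousAt_gquant hx) (hasDerivAt_gcdf _)
    (gpdf_pos _).ne' (Filter.eventually_of_mem (isOpen_Ioo.mem_nhds hx) fun _ => gcdf_gquant)

/-- The threshold `(t - s sin θ) / cos θ` for the conditional law of one coordinate of a
Gaussian pair with correlation `sin θ`, given the other one. -/
def gthr (θ s t : ℝ) : ℝ := (t - s * Real.sin θ) / Real.cos θ

lemma gpdf_mul_gpdf (u v : ℝ) :
    gpdf u * gpdf v = Real.exp (-(u ^ 2 + v ^ 2) / 2) / (2 * Real.pi) := by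
  unfold gpdf
  rw [div_mul_div_comm, ← Real.exp_add, Real.mul_self_sqrt (by positivity)]
  congr 2
  ring

lemma gpdf_mul_gthr_symm {θ : ℝ} (h : Real.cos θ ≠ 0) (s t : ℝ) :
    gpdf s * gpdf (gthr θ s t) = gpdf t * gpdf (gthr θ t s) := by
  rw [gpdf_mul_gpdf, gpdf_mul_gpdf]
  congr 3
  unfold gthr
  field_simp
  rw [Real.cos_sq']
  ring

/-- The excess over the independent value of the probability that both coordinates of a
Gaussian pair with correlation `sin β` lie below thresholds `s` and `t`. -/
def orthantExcess (β s t : ℝ) : ℝ := ∫ θ in (0 : ℝ)..β, gpdf s * gpdf (gthr θ s t)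

lemma cos_pos_of_mem {β θ : ℝ} (h0 : -(Real.pi / 2) < β) (hθ : θ ∈ Set.Icc β 0) :
    0 < Real.cos θ :=
  Real.cos_pos_of_mem_Ioo ⟨h0.trans_le hθ.1, hθ.2.trans_lt Real.pi_div_two_pos⟩

lemma hasDerivAt_gthr_left (θ s t : ℝ) :
    HasDerivAt (fun s => gthr θ s t) (-Real.sin θ / Real.cos θ) s := by
  exact (((hasDerivAt_id s).mul_const (Real.sin θ)).const_sub t).div_const (Real.cos θ)
    |>.congr_deriv (by simp)

lemma hasDerivAt_gthr_right (θ s t : ℝ) :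
    HasDerivAt (fun t => gthr θ s t) (1 / Real.cos θ) t := by
  unfold gthr
  exact ((hasDerivAt_id t).sub_const _).div_const (Real.cos θ)

lemma hasDerivAt_gthr_angle {θ : ℝ} (h : Real.cos θ ≠ 0) (s t : ℝ) :
    HasDerivAt (fun θ => gthr θ s t) ((t * Real.sin θ - s) / Real.cos θ ^ 2) θ := by
  refine ((((Real.hasDerivAt_sin θ).const_mul s).const_sub t).div
    (Real.hasDerivAt_cos θ) h).congr_deriv ?_
  congr 1
  linear_combination -s * Real.sin_sq_add_cos_sq θ

lemma continuousOn_gthr {β : ℝ} (hb0 : -(Real.pi / 2) < β) :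
    ContinuousOn (fun p : ℝ × ℝ × ℝ => gthr p.1 p.2.1 p.2.2) (Set.Icc β 0 ×ˢ Set.univ) := by
  unfold gthr
  refine ContinuousOn.div (by fun_prop) (by fun_prop) fun p hp => ?_
  exact (cos_pos_of_mem hb0 hp.1).ne'

lemma hasDerivAt_orthantExcess {β : ℝ} (hb0 : -(Real.pi / 2) < β) (hb1 : β ≤ 0) (s t : ℝ) :
    HasDerivAt (fun s => orthantExcess β s t) (gpdf s * (gcdf (gthr β s t) - gcdf t)) s := by
  have hI : Set.uIcc 0 β = Set.Icc β 0 := Set.uIcc_of_ge hb1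
  have hsub : ∀ θ ∈ Set.uIoc 0 β, θ ∈ Set.Icc β 0 := fun θ hθ => by
    rw [← hI]; exact Set.uIoc_subset_uIcc hθ
  set D : ℝ → ℝ → ℝ := fun s θ =>
    gpdf s * (gpdf (gthr θ s t) * ((t * Real.sin θ - s) / Real.cos θ ^ 2)) with hD
  have hw : ∀ s, ContinuousOn (fun θ => gthr θ s t) (Set.Icc β 0) := fun s =>
    (continuousOn_gthr hb0).comp (f := fun θ : ℝ => (θ, s, t)) (by fun_prop)
      fun θ hθ => ⟨hθ, trivial⟩
  have hF : ∀ s, ContinuousOn (fun θ => gpdf s * gpdf (gthr θ s t)) (Set.Icc β 0) := fun s =>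
    (continuous_gpdf.comp_continuousOn (hw s)).const_smul (gpdf s)
  have hDc : ContinuousOn (fun p : ℝ × ℝ => D p.1 p.2) (Metric.closedBall s 1 ×ˢ Set.Icc β 0) := by
    refine (continuous_gpdf.comp continuous_fst).continuousOn.mul (.mul ?_ ?_)
    · refine continuous_gpdf.comp_continuousOn ?_
      exact (continuousOn_gthr hb0).comp (f := fun p : ℝ × ℝ => (p.2, p.1, t)) (by fun_prop)
        fun p hp => ⟨hp.2, trivial⟩
    · refine ContinuousOn.div (by fun_prop) (by fun_prop) fun p hp => ?_
      exact pow_ne_zero 2 (cos_pos_of_mem hb0 hp.2).ne'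
  have hD1 : ContinuousOn (D s) (Set.Icc β 0) :=
    hDc.comp (f := fun θ : ℝ => (s, θ)) (by fun_prop)
      fun θ hθ => ⟨Metric.mem_closedBall_self zero_le_one, hθ⟩
  obtain ⟨K, hK⟩ := ((isCompact_closedBall s 1).prod isCompact_Icc).exists_bound_of_continuousOn hDc
  have hmeas : ∀ g : ℝ → ℝ, ContinuousOn g (Set.Icc β 0) → MeasureTheory.AEStronglyMeasurable g
      (MeasureTheory.volume.restrict (Set.uIoc 0 β)) := fun g hg =>
    (hg.mono hsub).aestronglyMeasurable measurableSet_uIoc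
  have key := intervalIntegral.hasDerivAt_integral_of_dominated_loc_of_deriv_le
    (μ := MeasureTheory.volume) (a := 0) (b := β) (bound := fun _ => K)
    (F := fun s θ => gpdf s * gpdf (gthr θ s t)) (F' := D) (x₀ := s)
    (Metric.closedBall_mem_nhds s one_pos) (Filter.Eventually.of_forall fun s => hmeas _ (hF s))
    (ContinuousOn.intervalIntegrable (by rw [hI]; exact hF s)) (hmeas _ hD1)
    (Filter.Eventually.of_forall fun θ hθ s' hs' => hK (s', θ) ⟨hs', hsub θ hθ⟩)
    intervalIntegrable_const
    (Filter.Eventually.of_forall fun θ hθ s' _ => by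
      have hc := (cos_pos_of_mem hb0 (hsub θ hθ)).ne'
      refine ((hasDerivAt_gpdf s').mul
        ((hasDerivAt_gpdf _).comp s' (hasDerivAt_gthr_left θ s' t))).congr_deriv ?_
      simp only [hD, gthr, Function.comp]
      field_simp
      rw [Real.cos_sq']
      ring)
  refine key.2.congr_deriv ?_
  rw [intervalIntegral.integral_eq_sub_of_hasDerivAt
    (f := fun θ => gpdf s * gcdf (gthr θ s t)) (f' := D s)]
  · simp only [gthr, Real.sin_zero, Real.cos_zero]
    ring_nf
  · intro θ hθ
    rw [hI] at hθ
    exact ((hasDerivAt_gcdf _).comp θ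
      (hasDerivAt_gthr_angle (cos_pos_of_mem hb0 hθ).ne' s t)).const_mul (gpdf s)
  · exact ContinuousOn.intervalIntegrable (by rw [hI]; exact hD1)

lemma orthantExcess_symm {β : ℝ} (hb0 : -(Real.pi / 2) < β) (hb1 : β ≤ 0) (s t : ℝ) :
    orthantExcess β s t = orthantExcess β t s := by
  refine intervalIntegral.integral_congr fun θ hθ => ?_
  rw [Set.uIcc_of_ge hb1] at hθ
  exact gpdf_mul_gthr_symm (cos_pos_of_mem hb0 hθ).ne' s t

lemma orthantExcess_nonpos {β : ℝ} (hb1 : β ≤ 0) (s t : ℝ) : orthantExcess β s t ≤ 0 := by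
  unfold orthantExcess
  rw [intervalIntegral.integral_symm, neg_nonpos]
  exact intervalIntegral.integral_nonneg hb1 fun θ _ => (mul_pos (gpdf_pos _) (gpdf_pos _)).le

lemma le_orthantExcess {β : ℝ} (hb0 : -(Real.pi / 2) < β) (hb1 : β ≤ 0) (s t : ℝ) :
    β / (2 * Real.pi) ≤ orthantExcess β s t := by
  unfold orthantExcess
  rw [intervalIntegral.integral_symm]
  have hw : ContinuousOn (fun θ => gpdf s * gpdf (gthr θ s t)) (Set.Icc β 0) :=
    (continuous_gpdf.comp_continuousOn
      ((continuousOn_gthr hb0).comp (f := fun θ : ℝ => (θ, s, t)) (by fun_prop)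
        fun θ hθ => ⟨hθ, trivial⟩)).const_smul (gpdf s)
  have h := intervalIntegral.integral_mono_on (μ := MeasureTheory.volume) hb1
    (ContinuousOn.intervalIntegrable (by rwa [Set.uIcc_of_le hb1]))
    (intervalIntegrable_const (c := 1 / (2 * Real.pi))) fun θ _ => (by
      rw [gpdf_mul_gpdf]
      gcongr
      exact Real.exp_le_one_iff.2 (by nlinarith [sq_nonneg s, sq_nonneg (gthr θ s t)]) :
      gpdf s * gpdf (gthr θ s t) ≤ 1 / (2 * Real.pi))
  rw [intervalIntegral.integral_const, smul_eq_mul] at h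
  have : (0 - β) * (1 / (2 * Real.pi)) = -(β / (2 * Real.pi)) := by ring
  linarith

/-- The two-function Gaussian isoperimetric profile, in terms of the means `x` and `y`, for
correlation `sin β`. -/
def profile (β x y : ℝ) : ℝ :=
  1 / 2 + 2 * (x - 1 / 2) * (y - 1 / 2) + 2 * orthantExcess β (gquant x) (gquant y)

/-- The partial derivative of `profile β` in its first argument. -/
def profileX (β x y : ℝ) : ℝ := 2 * gcdf (gthr β (gquant x) (gquant y)) - 1

/-- The second partial derivative of `profile β` in its first argument. -/
def profileXX (β x y : ℝ) : ℝ :=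
  2 * gpdf (gthr β (gquant x) (gquant y)) * (-Real.sin β / Real.cos β) / gpdf (gquant x)

/-- The mixed second partial derivative of `profile β`. -/
def profileXY (β x y : ℝ) : ℝ :=
  2 * gpdf (gthr β (gquant x) (gquant y)) * (1 / Real.cos β) / gpdf (gquant y)

lemma profile_le {β : ℝ} (hb1 : β ≤ 0) (x y : ℝ) :
    profile β x y ≤ 1 / 2 + 2 * (x - 1 / 2) * (y - 1 / 2) := by
  have := orthantExcess_nonpos hb1 (gquant x) (gquant y)
  unfold profile
  linarith

lemma le_profile {β : ℝ} (hb0 : -(Real.pi / 2) < β) (hb1 : β ≤ 0) (x y : ℝ) :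
    1 / 2 + β / Real.pi ≤ profile β x y + 1 / 2 * (x - y) ^ 2 := by
  have h := le_orthantExcess hb0 hb1 (gquant x) (gquant y)
  have h2 : β / Real.pi = 2 * (β / (2 * Real.pi)) := by field_simp
  unfold profile
  rw [h2]
  nlinarith [sq_nonneg (x + y - 1)]

lemma hasDerivAt_profileX_left {β x y : ℝ} (hx : x ∈ Set.Ioo (0 : ℝ) 1) :
    HasDerivAt (fun x => profileX β x y) (profileXX β x y) x := by
  have h := (hasDerivAt_gcdf _).comp x ((hasDerivAt_gthr_left β (gquant x) (gquant y)).comp x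
    (hasDerivAt_gquant hx))
  refine ((h.const_mul 2).sub_const 1).congr_deriv ?_
  simp only [profileXX, Function.comp_apply]
  ring

lemma hasDerivAt_profileX_right {β x y : ℝ} (hy : y ∈ Set.Ioo (0 : ℝ) 1) :
    HasDerivAt (fun y => profileX β x y) (profileXY β x y) y := by
  have h := (hasDerivAt_gcdf _).comp y ((hasDerivAt_gthr_right β (gquant x) (gquant y)).comp y
    (hasDerivAt_gquant hy))
  refine ((h.const_mul 2).sub_const 1).congr_deriv ?_
  simp only [profileXY, Function.comp_apply]
  ring

lemma profile_symm {β : ℝ} (hb0 : -(Real.pi / 2) < β) (hb1 : β < 0) {x y : ℝ} :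
    profile β x y = profile β y x := by
  unfold profile
  rw [orthantExcess_symm hb0 hb1.le]
  ring

lemma hasDerivAt_profile {β : ℝ} (hb0 : -(Real.pi / 2) < β) (hb1 : β < 0) {x y : ℝ}
    (hx : x ∈ Set.Ioo (0 : ℝ) 1) (hy : y ∈ Set.Ioo (0 : ℝ) 1) :
    HasDerivAt (fun x => profile β x y) (profileX β x y) x := by
  have h1 := (hasDerivAt_orthantExcess hb0 hb1.le (gquant x) (gquant y)).comp x
    (hasDerivAt_gquant hx)
  have h2 := ((((hasDerivAt_id x).sub_const (1 / 2)).const_mul 2).mul_const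
    (y - 1 / 2)).const_add (1 / 2)
  refine (h2.add (h1.const_mul 2)).congr_deriv ?_
  have := (gpdf_pos (gquant x)).ne'
  rw [gcdf_gquant hy, profileX]
  field_simp
  ring

lemma profileXX_pos {β : ℝ} (hb0 : -(Real.pi / 2) < β) (hb1 : β < 0) {x y : ℝ} :
    0 < profileXX β x y := by
  have h1 : Real.sin β < 0 := Real.sin_neg_of_neg_of_neg_pi_lt hb1 (by linarith [Real.pi_pos])
  have h2 := cos_pos_of_mem hb0 (Set.left_mem_Icc.2 hb1.le)
  unfold profileXX
  have := gpdf_pos (gquant x)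
  have := gpdf_pos (gthr β (gquant x) (gquant y))
  have : 0 < -Real.sin β := by linarith
  positivity

lemma profileXY_pos {β : ℝ} (hb0 : -(Real.pi / 2) < β) (hb1 : β < 0) {x y : ℝ} :
    0 < profileXY β x y := by
  have h2 := cos_pos_of_mem hb0 (Set.left_mem_Icc.2 hb1.le)
  unfold profileXY
  have := gpdf_pos (gquant y)
  have := gpdf_pos (gthr β (gquant x) (gquant y))
  positivity

lemma profileXX_mul_profileXX {β : ℝ} (hb0 : -(Real.pi / 2) < β) (hb1 : β < 0)
    {x y : ℝ} :
    profileXX β x y * profileXX β y x = Real.sin β ^ 2 * profileXY β x y ^ 2 := by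
  have h2 := (cos_pos_of_mem hb0 (Set.left_mem_Icc.2 hb1.le)).ne'
  have hx := (gpdf_pos (gquant x)).ne'
  have hy := (gpdf_pos (gquant y)).ne'
  have h := gpdf_mul_gthr_symm h2 (gquant x) (gquant y)
  unfold profileXX profileXY
  field_simp
  linear_combination
    (-gpdf (gthr β (gquant x) (gquant y)) * Real.sin β ^ 2) * h

lemma continuousAt_profileXX_profileXY {β x y : ℝ} (hx : x ∈ Set.Ioo (0 : ℝ) 1)
    (hy : y ∈ Set.Ioo (0 : ℝ) 1) :
    ContinuousAt (fun p : ℝ × ℝ => profileXX β p.1 p.2) (x, y) ∧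
      ContinuousAt (fun p : ℝ × ℝ => profileXX β p.2 p.1) (x, y) ∧
      ContinuousAt (fun p : ℝ × ℝ => profileXY β p.1 p.2) (x, y) := by
  have h1 : ContinuousAt (fun p : ℝ × ℝ => gquant p.1) (x, y) :=
    (continuousAt_gquant hx).comp_of_eq continuousAt_fst rfl
  have h2 : ContinuousAt (fun p : ℝ × ℝ => gquant p.2) (x, y) :=
    (continuousAt_gquant hy).comp_of_eq continuousAt_snd rfl
  have hp : ∀ f : ℝ × ℝ → ℝ, ContinuousAt f (x, y) → ContinuousAt (fun p => gpdf (f p)) (x, y) :=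
    fun f hf => continuous_gpdf.continuousAt.comp hf
  unfold profileXX profileXY gthr
  refine ⟨((continuousAt_const.mul (hp _ ?_)).mul_const _).div (hp _ h1) (gpdf_pos _).ne',
    ((continuousAt_const.mul (hp _ ?_)).mul_const _).div (hp _ h2) (gpdf_pos _).ne',
    ((continuousAt_const.mul (hp _ ?_)).mul_const _).div (hp _ h2) (gpdf_pos _).ne'⟩ <;> fun_prop

lemma exists_secondDiff_eq {f f' f'' : ℝ → ℝ} {a h : ℝ} (hh : 0 < h)
    (hf : ∀ x ∈ Set.Icc a (a + 2 * h), HasDerivAt f (f' x) x)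
    (hf' : ∀ x ∈ Set.Icc a (a + 2 * h), HasDerivAt f' (f'' x) x) :
    ∃ ξ ∈ Set.Icc a (a + 2 * h), f (a + 2 * h) - 2 * f (a + h) + f a = h ^ 2 * f'' ξ := by
  have hmem : ∀ x ∈ Set.Icc a (a + h), x ∈ Set.Icc a (a + 2 * h) ∧ x + h ∈ Set.Icc a (a + 2 * h) :=
    fun x hx => ⟨⟨hx.1, by linarith [hx.2]⟩, ⟨by linarith [hx.1], by linarith [hx.2]⟩⟩
  have hg : ∀ x ∈ Set.Icc a (a + h),
      HasDerivAt (fun x => f (x + h) - f x) (f' (x + h) - f' x) x := fun x hx =>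
    ((hf _ (hmem x hx).2).comp_add_const x h).sub (hf _ (hmem x hx).1)
  obtain ⟨c, hc, hce⟩ := exists_hasDerivAt_eq_slope (fun x => f (x + h) - f x)
    (fun x => f' (x + h) - f' x) (lt_add_of_pos_right a hh)
    (fun x hx => (hg x hx).continuousAt.continuousWithinAt)
    (fun x hx => hg x (Set.Ioo_subset_Icc_self hx))
  have hsub : ∀ x ∈ Set.Icc c (c + h), x ∈ Set.Icc a (a + 2 * h) := fun x hx =>
    ⟨by linarith [hx.1, hc.1], by linarith [hx.2, hc.2]⟩
  obtain ⟨ξ, hξ, hξe⟩ := exists_hasDerivAt_eq_slope f' f'' (lt_add_of_pos_right c hh)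
    (fun x hx => (hf' x (hsub x hx)).continuousAt.continuousWithinAt)
    (fun x hx => hf' x (hsub x (Set.Ioo_subset_Icc_self hx)))
  refine ⟨ξ, hsub ξ (Set.Ioo_subset_Icc_self hξ), ?_⟩
  rw [add_sub_cancel_left, eq_div_iff hh.ne'] at hce hξe
  rw [show a + 2 * h = a + h + h by ring]
  linear_combination -hce - h * hξe

lemma exists_mixedDiff_eq {f f₁ f₁₂ : ℝ → ℝ → ℝ} {a b h : ℝ} (hh : 0 < h)
    (hf : ∀ x ∈ Set.Icc a (a + h), ∀ y ∈ Set.Icc b (b + h),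
      HasDerivAt (fun x => f x y) (f₁ x y) x)
    (hf' : ∀ x ∈ Set.Icc a (a + h), ∀ y ∈ Set.Icc b (b + h),
      HasDerivAt (fun y => f₁ x y) (f₁₂ x y) y) :
    ∃ ξ ∈ Set.Icc a (a + h), ∃ η ∈ Set.Icc b (b + h),
      f (a + h) (b + h) - f (a + h) b - f a (b + h) + f a b = h ^ 2 * f₁₂ ξ η := by
  have hb : b ∈ Set.Icc b (b + h) := ⟨le_rfl, by linarith⟩
  have hb' : b + h ∈ Set.Icc b (b + h) := ⟨by linarith, le_rfl⟩
  have hg : ∀ x ∈ Set.Icc a (a + h),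
      HasDerivAt (fun x => f x (b + h) - f x b) (f₁ x (b + h) - f₁ x b) x := fun x hx =>
    (hf x hx _ hb').sub (hf x hx _ hb)
  obtain ⟨ξ, hξ, hξe⟩ := exists_hasDerivAt_eq_slope (fun x => f x (b + h) - f x b)
    (fun x => f₁ x (b + h) - f₁ x b) (lt_add_of_pos_right a hh)
    (fun x hx => (hg x hx).continuousAt.continuousWithinAt)
    (fun x hx => hg x (Set.Ioo_subset_Icc_self hx))
  have hξ' := Set.Ioo_subset_Icc_self hξ
  obtain ⟨η, hη, hηe⟩ := exists_hasDerivAt_eq_slope (fun y => f₁ ξ y) (fun y => f₁₂ ξ y)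
    (lt_add_of_pos_right b hh)
    (fun y hy => (hf' ξ hξ' y hy).continuousAt.continuousWithinAt)
    (fun y hy => hf' ξ hξ' y (Set.Ioo_subset_Icc_self hy))
  refine ⟨ξ, hξ', η, Set.Ioo_subset_Icc_self hη, ?_⟩
  rw [add_sub_cancel_left, eq_div_iff hh.ne'] at hξe hηe
  linear_combination -hξe - h * hηe

/-- Near the diagonal of a compact square, the Hessian of `profile β` with its off-diagonal
entry rescaled by `r`, where `r ^ 2 < sin β ^ 2`, remains positive even when its three entries
are evaluated at different points. -/
lemma exists_profile_hessian_pos {β : ℝ} (hb0 : -(Real.pi / 2) < β) (hb1 : β < 0) {r ε : ℝ}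
    (hr : r ^ 2 < Real.sin β ^ 2) (hε : 0 < ε) :
    ∃ δ > 0, ∀ p ∈ Set.Icc ε (1 - ε) ×ˢ Set.Icc ε (1 - ε),
      ∀ q ∈ Set.Icc ε (1 - ε) ×ˢ Set.Icc ε (1 - ε), ∀ z ∈ Set.Icc ε (1 - ε) ×ˢ Set.Icc ε (1 - ε),
      dist q p < δ → dist z p < δ →
      r ^ 2 * profileXY β z.1 z.2 ^ 2 < profileXX β p.1 p.2 * profileXX β q.2 q.1 := by
  set K : Set (ℝ × ℝ) := Set.Icc ε (1 - ε) ×ˢ Set.Icc ε (1 - ε) with hK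
  have hKc : IsCompact K := isCompact_Icc.prod isCompact_Icc
  have hmem : ∀ p ∈ K, p.1 ∈ Set.Ioo (0 : ℝ) 1 ∧ p.2 ∈ Set.Ioo (0 : ℝ) 1 := fun p hp =>
    ⟨⟨by linarith [hp.1.1], by linarith [hp.1.2]⟩, ⟨by linarith [hp.2.1], by linarith [hp.2.2]⟩⟩
  have hcont : ∀ p ∈ K, _ := fun p hp =>
    continuousAt_profileXX_profileXY (β := β) (hmem p hp).1 (hmem p hp).2
  have c1 : ContinuousOn (fun p : ℝ × ℝ => profileXX β p.1 p.2) K := fun p hp =>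
    (hcont p hp).1.continuousWithinAt
  have c2 : ContinuousOn (fun p : ℝ × ℝ => profileXX β p.2 p.1) K := fun p hp =>
    (hcont p hp).2.1.continuousWithinAt
  have c3 : ContinuousOn (fun p : ℝ × ℝ => profileXY β p.1 p.2) K := fun p hp =>
    (hcont p hp).2.2.continuousWithinAt
  set Ω : (ℝ × ℝ) × (ℝ × ℝ) × (ℝ × ℝ) → ℝ := fun w =>
    profileXX β w.1.1 w.1.2 * profileXX β w.2.1.2 w.2.1.1
      - r ^ 2 * profileXY β w.2.2.1 w.2.2.2 ^ 2 with hΩ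
  have hΩc : ContinuousOn Ω (K ×ˢ K ×ˢ K) := by
    refine .sub (.mul ?_ ?_) (.mul continuousOn_const (.pow ?_ 2))
    · exact c1.comp (f := fun w : (ℝ × ℝ) × (ℝ × ℝ) × (ℝ × ℝ) => w.1) (by fun_prop)
        fun w hw => hw.1
    · exact c2.comp (f := fun w : (ℝ × ℝ) × (ℝ × ℝ) × (ℝ × ℝ) => w.2.1) (by fun_prop)
        fun w hw => hw.2.1
    · exact c3.comp (f := fun w : (ℝ × ℝ) × (ℝ × ℝ) × (ℝ × ℝ) => w.2.2) (by fun_prop)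
        fun w hw => hw.2.2
  rcases K.eq_empty_or_nonempty with hKe | hKne
  · exact ⟨1, one_pos, fun p hp => by simp [hKe] at hp⟩
  have hdiag : ContinuousOn (fun p : ℝ × ℝ => Ω (p, p, p)) K :=
    hΩc.comp (f := fun p : ℝ × ℝ => (p, p, p)) (by fun_prop) fun p hp => ⟨hp, hp, hp⟩
  obtain ⟨p₀, hp₀, hmin⟩ := hKc.exists_isMinOn hKne hdiag
  have hpos : 0 < Ω (p₀, p₀, p₀) := by
    have h1 := profileXX_mul_profileXX hb0 hb1 (x := p₀.1) (y := p₀.2)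
    have h2 := profileXY_pos hb0 hb1 (x := p₀.1) (y := p₀.2)
    simp only [hΩ, h1]
    rw [← sub_mul]
    exact mul_pos (sub_pos.2 hr) (pow_pos h2 2)
  have hu := (hKc.prod (hKc.prod hKc)).uniformContinuousOn_of_continuous hΩc
  obtain ⟨δ, hδ, hδu⟩ := Metric.uniformContinuousOn_iff.1 hu _ hpos
  refine ⟨δ, hδ, fun p hp q hq z hz hqp hzp => ?_⟩
  have h := hδu (p, q, z) ⟨hp, hq, hz⟩ (p, p, p) ⟨hp, hp, hp⟩ (by
    simp only [Prod.dist_eq, dist_self, sup_lt_iff] at hqp hzp ⊢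
    exact ⟨hδ, hqp, hzp⟩)
  rw [Real.dist_eq, abs_lt] at h
  have h3 : Ω (p₀, p₀, p₀) ≤ Ω (p, p, p) := hmin hp
  have h4 : 0 < Ω (p, q, z) := by linarith [h.1]
  simp only [hΩ] at h4
  linarith

/-- A grid function whose second differences satisfy the discrete form of the Hessian condition
for correlation `ρ`, which is dominated by the bilinear function `1 - x - y + 2 x y` and whose
values near the diagonal are at least `1 / 2 + β / π`. -/
structure IsGridProfile (β ρ κ : ℝ) (M : ℕ) (c : ℕ → ℕ → ℝ) : Prop where
  inv_le : 1 / ((M : ℝ) + 2) ≤ κ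
  hessian : ∀ i ≤ M, ∀ j ≤ M, ∀ k ≤ 2, ∀ l ≤ 2, ∀ k' ≤ 1, ∀ l' ≤ 1,
    0 < c (i + 2) (j + l) - 2 * c (i + 1) (j + l) + c i (j + l) ∧
    0 < c (i + k) (j + 2) - 2 * c (i + k) (j + 1) + c (i + k) j ∧
    (((M : ℝ) + 2) * ρ * (c (i + k' + 1) (j + l' + 1) - c (i + k' + 1) (j + l')
      - c (i + k') (j + l' + 1) + c (i + k') (j + l'))) ^ 2 ≤ ((M : ℝ) + 1) ^ 2 *
      ((c (i + 2) (j + l) - 2 * c (i + 1) (j + l) + c i (j + l)) *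
        (c (i + k) (j + 2) - 2 * c (i + k) (j + 1) + c (i + k) j))
  le_bilin : ∀ i ≤ M + 2, ∀ j ≤ M + 2, c i j ≤ 1 - i / ((M : ℝ) + 2) - j / ((M : ℝ) + 2)
    + 2 * (i / ((M : ℝ) + 2)) * (j / ((M : ℝ) + 2)) + κ
  le_near_diag : ∀ i j : ℕ, 1 / 2 + β / Real.pi ≤
    c i j + 1 / 2 * (i / ((M : ℝ) + 2) - j / ((M : ℝ) + 2)) ^ 2

lemma shrunk_bilin_le {ε κ x y : ℝ} (hε : 0 ≤ ε) (hε4 : ε ≤ 1 / 4) (hεκ : ε ≤ κ / 2)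
    (hx0 : 0 ≤ x) (hx1 : x ≤ 1) (hy0 : 0 ≤ y) (hy1 : y ≤ 1) :
    1 / 2 + 2 * (ε + (1 - 2 * ε) * x - 1 / 2) * (ε + (1 - 2 * ε) * y - 1 / 2)
      ≤ 1 - x - y + 2 * x * y + κ := by
  have hxy : -((x - 1 / 2) * (y - 1 / 2)) ≤ 1 / 4 := by
    nlinarith [mul_nonneg hx0 hy0, mul_nonneg (sub_nonneg.2 hx1) (sub_nonneg.2 hy1)]
  have h0 : 0 ≤ 8 * (ε * (1 - ε)) := mul_nonneg (by norm_num) (mul_nonneg hε (by linarith))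
  have h1 := mul_le_mul_of_nonneg_left hxy h0
  nlinarith [sq_nonneg ε]

lemma exists_isGridProfile {β : ℝ} (hb0 : -(Real.pi / 2) < β) (hb1 : β < 0) {ρ κ : ℝ}
    (hρ : ρ ^ 2 < Real.sin β ^ 2) (hκ : 0 < κ) :
    ∃ (M : ℕ) (c : ℕ → ℕ → ℝ), IsGridProfile β ρ κ M c := by
  obtain ⟨r, hr1, hr2⟩ := exists_between (sq_lt_sq.1 hρ)
  have hr0 : 0 < r := (abs_nonneg _).trans_lt hr1
  have hrs : r ^ 2 < Real.sin β ^ 2 := by rw [sq_lt_sq, abs_of_pos hr0]; exact hr2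
  set ε : ℝ := min (κ / 2) (1 / 4) with hεd
  have hε : 0 < ε := by positivity
  have hε4 : ε ≤ 1 / 4 := min_le_right _ _
  have hεκ : ε ≤ κ / 2 := min_le_left _ _
  obtain ⟨δ, hδ, hδp⟩ := exists_profile_hessian_pos hb0 hb1 hrs hε
  obtain ⟨M, hM⟩ := exists_nat_gt (max (r / (r - |ρ|)) (max (1 / κ) (2 / δ)))
  have hM1 : r / (r - |ρ|) < M := (le_max_left _ _).trans_lt hM
  have hM2 : 1 / κ < M := ((le_max_left _ _).trans (le_max_right _ _)).trans_lt hM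
  have hM3 : 2 / δ < M := ((le_max_right _ _).trans (le_max_right _ _)).trans_lt hM
  have hM0 : (0 : ℝ) ≤ M := Nat.cast_nonneg M
  set N : ℝ := (M : ℝ) + 2 with hN
  have hN0 : 0 < N := by positivity
  have hMN : (M : ℝ) < N := by rw [hN]; linarith
  set h : ℝ := (1 - 2 * ε) / N with hh
  have hh0 : 0 < h := div_pos (by linarith) hN0
  have hhN : N * h = 1 - 2 * ε := by rw [hh]; field_simp
  have h2δ : 2 * h < δ := by
    rw [div_lt_iff₀ hδ] at hM3
    have : N * (2 * h) < N * δ := by nlinarith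
    exact lt_of_mul_lt_mul_left this hN0.le
  have hNr : N * |ρ| ≤ (N - 1) * r := by
    rw [div_lt_iff₀ (by linarith)] at hM1
    nlinarith
  set P : ℕ → ℝ := fun i => ε + i * h with hP
  have hP1 : ∀ i, P (i + 1) = P i + h := fun i => by simp only [hP]; push_cast; ring
  have hP2 : ∀ i, P (i + 2) = P i + 2 * h := fun i => by simp only [hP]; push_cast; ring
  have hPe : ∀ i : ℕ, P i = ε + (1 - 2 * ε) * (i / N) := fun i => by
    simp only [hP, ← hhN]; field_simp
  have hPI : ∀ i ≤ M, Set.Icc (P i) (P i + 2 * h) ⊆ Set.Icc ε (1 - ε) := fun i hi x hx => by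
    have h1 : (i : ℝ) ≤ M := by exact_mod_cast hi
    have h2 : ((i : ℝ) + 2) * h ≤ N * h := by gcongr; linarith
    simp only [hP] at hx
    exact ⟨by nlinarith [hx.1, (Nat.cast_nonneg i : (0 : ℝ) ≤ i)], by linarith [hx.2]⟩
  have hI01 : ∀ x ∈ Set.Icc ε (1 - ε), x ∈ Set.Ioo (0 : ℝ) 1 := fun x hx =>
    ⟨by linarith [hx.1], by linarith [hx.2]⟩
  have hPk : ∀ i, ∀ k ≤ 2, P (i + k) ∈ Set.Icc (P i) (P i + 2 * h) := fun i k hk => by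
    have : (k : ℝ) ≤ 2 := by exact_mod_cast hk
    simp only [hP]
    push_cast
    exact ⟨by nlinarith [(Nat.cast_nonneg k : (0 : ℝ) ≤ k)], by nlinarith⟩
  clear_value P h N ε
  refine ⟨M, fun i j => profile β (P i) (P j), ?_, ?_, ?_, ?_⟩
  · rw [← hN, div_le_iff₀ hN0]
    rw [div_lt_iff₀ hκ] at hM2
    nlinarith
  · intro i hi j hj k hk l hl k' hk' l' hl'
    have hIi := hPI i hi
    have hIj := hPI j hj
    have hjl := hPk j l hl
    have hik := hPk i k hk
    obtain ⟨ξ, hξ, hξe⟩ := exists_secondDiff_eq (f := fun x => profile β x (P (j + l)))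
      (f' := fun x => profileX β x (P (j + l))) (f'' := fun x => profileXX β x (P (j + l)))
      (a := P i) hh0
      (fun x hx => hasDerivAt_profile hb0 hb1 (hI01 x (hIi hx)) (hI01 _ (hIj hjl)))
      (fun x hx => hasDerivAt_profileX_left (hI01 x (hIi hx)))
    obtain ⟨η, hη, hηe⟩ := exists_secondDiff_eq (f := fun y => profile β y (P (i + k)))
      (f' := fun y => profileX β y (P (i + k))) (f'' := fun y => profileXX β y (P (i + k)))
      (a := P j) hh0
      (fun y hy => hasDerivAt_profile hb0 hb1 (hI01 y (hIj hy)) (hI01 _ (hIi hik)))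
      (fun y hy => hasDerivAt_profileX_left (hI01 y (hIj hy)))
    simp only [← profile_symm hb0 hb1 (x := P (i + k))] at hηe
    have hsub : ∀ i, ∀ k' ≤ 1, Set.Icc (P (i + k')) (P (i + k') + h) ⊆
        Set.Icc (P i) (P i + 2 * h) := fun i k' hk' => by
      have : (k' : ℝ) ≤ 1 := by exact_mod_cast hk'
      refine Set.Icc_subset_Icc (hPk i k' (by lia)).1 ?_
      simp only [hP]
      push_cast
      nlinarith
    have hsi := hsub i k' hk'
    have hsj := hsub j l' hl'
    obtain ⟨u, hu, v, hv, huv⟩ := exists_mixedDiff_eq (f := profile β) (f₁ := profileX β)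
      (f₁₂ := profileXY β) (a := P (i + k')) (b := P (j + l')) hh0
      (fun x hx y hy => hasDerivAt_profile hb0 hb1 (hI01 x (hIi (hsi hx)))
        (hI01 y (hIj (hsj hy))))
      (fun x hx y hy => hasDerivAt_profileX_right (hI01 y (hIj (hsj hy))))
    simp only [hP2]
    simp only [hP1]
    rw [hξe, hηe, huv, ← hN]
    have hdist : ∀ i, ∀ x ∈ Set.Icc (P i) (P i + 2 * h), ∀ y ∈ Set.Icc (P i) (P i + 2 * h),
        dist x y < δ := fun i x hx y hy => by
      rw [Real.dist_eq, abs_lt]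
      constructor <;> linarith [hx.1, hx.2, hy.1, hy.2]
    have hmain := hδp (ξ, P (j + l)) ⟨hIi hξ, hIj hjl⟩ (P (i + k), η) ⟨hIi hik, hIj hη⟩ (u, v)
      ⟨hIi (hsi hu), hIj (hsj hv)⟩
      (max_lt (hdist i _ hik _ hξ) (hdist j _ hη _ hjl))
      (max_lt (hdist i _ (hsi hu) _ hξ) (hdist j _ (hsj hv) _ hjl))
    refine ⟨mul_pos (by positivity) (profileXX_pos hb0 hb1),
      mul_pos (by positivity) (profileXX_pos hb0 hb1), ?_⟩
    have e1 : (N * ρ) ^ 2 ≤ ((M : ℝ) + 1) ^ 2 * r ^ 2 := by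
      rw [← mul_pow, show (M : ℝ) + 1 = N - 1 by rw [hN]; ring, sq_le_sq, abs_mul,
        abs_of_pos hN0]
      exact hNr.trans (le_abs_self _)
    calc (N * ρ * (h ^ 2 * profileXY β u v)) ^ 2
        = (N * ρ) ^ 2 * ((h ^ 2) ^ 2 * profileXY β u v ^ 2) := by ring
      _ ≤ ((M : ℝ) + 1) ^ 2 * r ^ 2 * ((h ^ 2) ^ 2 * profileXY β u v ^ 2) := by gcongr
      _ = ((M : ℝ) + 1) ^ 2 * (h ^ 2) ^ 2 * (r ^ 2 * profileXY β u v ^ 2) := by ring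
      _ ≤ ((M : ℝ) + 1) ^ 2 * (h ^ 2) ^ 2 *
          (profileXX β ξ (P (j + l)) * profileXX β η (P (i + k))) := by
        exact mul_le_mul_of_nonneg_left hmain.le (by positivity)
      _ = _ := by ring
  · intro i hi j hj
    have hi' : (i : ℝ) / N ≤ 1 := by rw [div_le_one hN0, hN]; exact_mod_cast hi
    have hj' : (j : ℝ) / N ≤ 1 := by rw [div_le_one hN0, hN]; exact_mod_cast hj
    have hi0 : 0 ≤ (i : ℝ) / N := by positivity
    have hj0 : 0 ≤ (j : ℝ) / N := by positivity
    refine (profile_le hb1.le _ _).trans ?_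
    rw [hPe, hPe, ← hN]
    exact shrunk_bilin_le hε.le hε4 hεκ hi0 hi' hj0 hj'
  · intro i j
    refine (le_profile hb0 hb1.le (P i) (P j)).trans ?_
    rw [hPe, hPe, ← hN]
    have h1 : (1 - 2 * ε) ^ 2 ≤ 1 := pow_le_one₀ (by linarith) (by linarith)
    have h2 := mul_le_of_le_one_left (sq_nonneg ((i : ℝ) / N - j / N)) h1
    have h3 : (ε + (1 - 2 * ε) * (i / N) - (ε + (1 - 2 * ε) * (j / N))) ^ 2
        = (1 - 2 * ε) ^ 2 * (i / N - j / N) ^ 2 := by ring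
    rw [h3]
    linarith

/-- The Bernstein polynomial of order `N` of the grid function `c`, at the point `(x, y)` of an
`ℝ`-algebra. -/
def bernstein₂ {U : Type*} [CommRing U] [Algebra ℝ U] (N : ℕ) (c : ℕ → ℕ → ℝ) (x y : U) : U :=
  ∑ i ∈ Finset.range (N + 1), ∑ j ∈ Finset.range (N + 1), algebraMap ℝ U (c i j) *
    (Polynomial.aeval x (bernsteinPolynomial ℝ N i) *
      Polynomial.aeval y (bernsteinPolynomial ℝ N j))

lemma map_bernstein₂ {U V : Type*} [CommRing U] [Algebra ℝ U] [CommRing V] [Algebra ℝ V]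
    (φ : U →ₐ[ℝ] V) (N : ℕ) (c : ℕ → ℕ → ℝ) (x y : U) :
    φ (bernstein₂ N c x y) = bernstein₂ N c (φ x) (φ y) := by
  simp [bernstein₂, map_sum, Polynomial.aeval_algHom_apply]

section Bernstein

variable {U : Type*} [CommRing U] [Algebra ℝ U]

lemma aeval_bernstein (N i : ℕ) (x : U) : Polynomial.aeval x (bernsteinPolynomial ℝ N i) =
    (N.choose i : U) * x ^ i * (1 - x) ^ (N - i) := by
  simp [bernsteinPolynomial]

/-- The linear functional on polynomials in two shift variables that sends `S ^ i * T ^ j` to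
`c i j`. -/
def shiftEval (U : Type*) [CommRing U] [Algebra ℝ U] (c : ℕ → ℕ → ℝ) :
    MvPolynomial (Fin 2) U →ₗ[U] U :=
  (MvPolynomial.basisMonomials (Fin 2) U).constr U fun m => algebraMap ℝ U (c (m 0) (m 1))

lemma shiftEval_X_pow (c : ℕ → ℕ → ℝ) (i j : ℕ) :
    shiftEval U c (X 0 ^ i * X 1 ^ j) = algebraMap ℝ U (c i j) := by
  have h : (X 0 ^ i * X 1 ^ j : MvPolynomial (Fin 2) U) =
      MvPolynomial.basisMonomials (Fin 2) U (Finsupp.single 0 i + Finsupp.single 1 j) := by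
    simp [X_pow_eq_monomial, monomial_mul]
  rw [h, shiftEval, Module.Basis.constr_basis]
  simp

lemma shiftEval_C_mul (c : ℕ → ℕ → ℝ) (u : U) (p : MvPolynomial (Fin 2) U) :
    shiftEval U c (C u * p) = u * shiftEval U c p := by
  rw [C_mul', map_smul, smul_eq_mul]

/-- The convex combination of `1` and `s` with weights `1 - x` and `x`. -/
def bary (x : U) (s : MvPolynomial (Fin 2) U) : MvPolynomial (Fin 2) U := C (1 - x) + C x * s

lemma bernstein₂_eq_shiftEval (N : ℕ) (c : ℕ → ℕ → ℝ) (x y : U) : bernstein₂ N c x y =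
    shiftEval U c (bary x (X 0) ^ N * bary y (X 1) ^ N) := by
  rw [bary, bary, add_comm (C (1 - x)), add_comm (C (1 - y)), add_pow, add_pow,
    Finset.sum_mul_sum, map_sum, bernstein₂]
  refine Finset.sum_congr rfl fun i _ => ?_
  rw [map_sum]
  refine Finset.sum_congr rfl fun j _ => ?_
  have h : (C x * X 0) ^ i * C (1 - x) ^ (N - i) * (N.choose i : MvPolynomial (Fin 2) U) *
      ((C y * X 1) ^ j * C (1 - y) ^ (N - j) * (N.choose j : MvPolynomial (Fin 2) U)) =
      C (((N.choose i : U) * x ^ i * (1 - x) ^ (N - i)) *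
        ((N.choose j : U) * y ^ j * (1 - y) ^ (N - j))) * (X 0 ^ i * X 1 ^ j) := by
    simp only [map_mul, map_pow, map_natCast]
    ring
  rw [h, shiftEval_C_mul, shiftEval_X_pow, aeval_bernstein, aeval_bernstein, mul_comm]

/-- The even and odd parts of `(e + a δ) ^ (M + 2)` to fourth order in `a`. -/
lemma exists_add_mul_pow_eq {R : Type*} [CommRing R] (e δ a : R) (M : ℕ) :
    ∃ r s : R, ∀ t : R, t ^ 2 = 1 → (e + t * a * δ) ^ (M + 2) =
      (e ^ (M + 2) + ((M + 2).choose 2 : R) * a ^ 2 * (e ^ M * δ ^ 2) + a ^ 4 * r) +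
        t * a * (((M : R) + 2) * (e ^ (M + 1) * δ) + a ^ 2 * s) := by
  induction M with
  | zero =>
    refine ⟨0, 0, fun t ht => ?_⟩
    simp
    linear_combination a ^ 2 * δ ^ 2 * ht
  | succ M ih =>
    obtain ⟨r, s, h⟩ := ih
    refine ⟨r * e + s * δ,
      s * e + ((M + 2).choose 2 : R) * (e ^ M * δ ^ 3) + a ^ 2 * (r * δ), fun t ht => ?_⟩
    rw [show M + 1 + 2 = (M + 2) + 1 by ring, pow_succ, h t ht, Nat.choose_succ_succ' (M + 2) 1,
      Nat.choose_one_right]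
    push_cast
    linear_combination (a ^ 2 * δ * (((M : R) + 2) * (e ^ (M + 1) * δ) + a ^ 2 * s)) * ht

variable {T : Subsemiring U}

/-- A subsemiring of an `ℝ`-algebra that contains the squares contains the nonnegative reals. -/
lemma algebraMap_mem_of_nonneg (hT : ∀ z : U, z ^ 2 ∈ T) {r : ℝ} (hr : 0 ≤ r) :
    algebraMap ℝ U r ∈ T := by
  rw [← Real.sq_sqrt hr, map_pow]
  exact hT _

lemma algebraMap_mul_mem (hT : ∀ z : U, z ^ 2 ∈ T) {r : ℝ} (hr : 0 ≤ r) {z : U} (hz : z ∈ T) :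
    algebraMap ℝ U r * z ∈ T :=
  T.mul_mem (algebraMap_mem_of_nonneg hT hr) hz

lemma mem_of_two_mul_mem (hT : ∀ z : U, z ^ 2 ∈ T) {z : U} (hz : 2 * z ∈ T) : z ∈ T := by
  have h := algebraMap_mul_mem hT (r := 1 / 2) (by norm_num) hz
  rwa [← mul_assoc, ← map_ofNat (algebraMap ℝ U) 2, ← map_mul, show (1 / 2 * 2 : ℝ) = 1 by norm_num,
    map_one, one_mul] at h

/-- A positive semidefinite binary quadratic form is a sum of squares. -/
lemma quadForm_mem (hT : ∀ z : U, z ^ 2 ∈ T) {A B H : ℝ} (hA : 0 < A) (hH : H ^ 2 ≤ A * B)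
    (a b : U) : algebraMap ℝ U A * a ^ 2 + algebraMap ℝ U B * b ^ 2 +
      algebraMap ℝ U (2 * H) * (a * b) ∈ T := by
  have h : algebraMap ℝ U A * a ^ 2 + algebraMap ℝ U B * b ^ 2 + algebraMap ℝ U (2 * H) * (a * b)
      = algebraMap ℝ U A * (a + algebraMap ℝ U (H / A) * b) ^ 2 +
        algebraMap ℝ U (B - H ^ 2 / A) * b ^ 2 := by
    have e1 : algebraMap ℝ U (2 * H) = 2 * (algebraMap ℝ U A * algebraMap ℝ U (H / A)) := by
      rw [← map_mul, map_mul, map_ofNat, mul_div_cancel₀ _ hA.ne']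
    have e2 : algebraMap ℝ U (B - H ^ 2 / A) = algebraMap ℝ U B -
        algebraMap ℝ U A * algebraMap ℝ U (H / A) ^ 2 := by
      rw [← map_pow, ← map_mul, ← map_sub]
      congr 1
      field_simp
    rw [e1, e2]
    ring
  rw [h]
  refine T.add_mem (algebraMap_mul_mem hT hA.le (hT _)) (algebraMap_mul_mem hT ?_ (hT _))
  rw [sub_nonneg, div_le_iff₀ hA]
  linarith

/-- Expanding a power of the convex combination `(1 - x) + x s` under a linear functional. -/
lemma add_shiftEval_pow_mul_mem (c : ℕ → ℕ → ℝ) {x : U} (hx : x ∈ T) (hx' : 1 - x ∈ T) (p : U)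
    (s : MvPolynomial (Fin 2) U) (M : ℕ) (V : MvPolynomial (Fin 2) U)
    (h : ∀ i ≤ M, p + shiftEval U c (s ^ i * V) ∈ T) :
    p + shiftEval U c (bary x s ^ M * V) ∈ T := by
  induction M generalizing V with
  | zero => simpa using h 0 le_rfl
  | succ M ih =>
    have h0 := ih V fun i hi => h i (by lia)
    have h1 := ih (s * V) fun i hi => by
      rw [← mul_assoc, ← pow_succ]
      exact h (i + 1) (by lia)
    have e : bary x s ^ (M + 1) * V =
        C (1 - x) * (bary x s ^ M * V) + C x * (bary x s ^ M * (s * V)) := by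
      rw [bary]
      ring
    rw [e, map_add, shiftEval_C_mul, shiftEval_C_mul]
    have := T.add_mem (T.mul_mem hx' h0) (T.mul_mem hx h1)
    convert this using 1
    ring

/-- A quantity is negligible if it is bounded below by a multiple of `-(a ^ 4 + b ^ 4)`. -/
def IsQuartic (T : Subsemiring U) (a b z : U) : Prop :=
  ∃ K : ℝ, 0 ≤ K ∧ algebraMap ℝ U K * (a ^ 4 + b ^ 4) + z ∈ T

lemma IsQuartic.add {a b z w : U} (hz : IsQuartic T a b z) (hw : IsQuartic T a b w) :
    IsQuartic T a b (z + w) := by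
  obtain ⟨K, hK, h⟩ := hz
  obtain ⟨L, hL, h'⟩ := hw
  refine ⟨K + L, add_nonneg hK hL, ?_⟩
  convert T.add_mem h h' using 1
  rw [map_add]
  ring

lemma IsQuartic.swap {a b z : U} (hz : IsQuartic T b a z) : IsQuartic T a b z := by
  simpa only [IsQuartic, add_comm (b ^ 4)] using hz

lemma isQuartic_pow_four_mul (hT : ∀ z : U, z ^ 2 ∈ T)
    (hbd : ∀ z : U, ∃ K : ℝ, 0 ≤ K ∧ algebraMap ℝ U K - z ∈ T ∧ algebraMap ℝ U K + z ∈ T)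
    (a b z : U) : IsQuartic T a b (a ^ 4 * z) := by
  obtain ⟨K, hK, -, h⟩ := hbd z
  refine ⟨K, hK, ?_⟩
  convert T.add_mem (T.mul_mem (hT (a ^ 2)) h) (algebraMap_mul_mem hT hK (hT (b ^ 2))) using 1
  ring

lemma isQuartic_sq_mul_sq_mul (hT : ∀ z : U, z ^ 2 ∈ T)
    (hbd : ∀ z : U, ∃ K : ℝ, 0 ≤ K ∧ algebraMap ℝ U K - z ∈ T ∧ algebraMap ℝ U K + z ∈ T)
    (a b z : U) : IsQuartic T a b (a ^ 2 * b ^ 2 * z) := by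
  obtain ⟨K, hK, -, h⟩ := hbd z
  refine ⟨K, hK, mem_of_two_mul_mem hT ?_⟩
  convert T.add_mem (T.add_mem (T.mul_mem (hT (a * b)) h) (T.mul_mem (hT (a * b)) h))
    (algebraMap_mul_mem hT hK (T.add_mem (T.add_mem (hT (a ^ 2 - b ^ 2)) (hT (a ^ 2)))
      (hT (b ^ 2)))) using 1
  ring

lemma isQuartic_cube_mul_mul (hT : ∀ z : U, z ^ 2 ∈ T)
    (hbd : ∀ z : U, ∃ K : ℝ, 0 ≤ K ∧ algebraMap ℝ U K - z ∈ T ∧ algebraMap ℝ U K + z ∈ T)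
    (a b z : U) : IsQuartic T a b (a ^ 3 * b * z) := by
  obtain ⟨K, hK, h', h⟩ := hbd z
  refine ⟨K, hK, mem_of_two_mul_mem hT <| mem_of_two_mul_mem hT ?_⟩
  convert T.add_mem (T.mul_mem (hT a) (T.add_mem (T.mul_mem (hT (a + b)) h)
    (T.mul_mem (hT (a - b)) h'))) (algebraMap_mul_mem hT hK (T.add_mem (hT (a ^ 2 - b ^ 2))
      (T.add_mem (hT (a ^ 2)) (T.add_mem (hT (b ^ 2)) (T.add_mem (hT (b ^ 2)) (hT (b ^ 2)))))))
    using 1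
  ring

lemma shiftEval_split_mem (c : ℕ → ℕ → ℝ) {x y : U} (hx : x ∈ T) (hx' : 1 - x ∈ T) (hy : y ∈ T)
    (hy' : 1 - y ∈ T) (p q r : MvPolynomial (Fin 2) U)
    (h : ∀ k ≤ 2, ∀ l ≤ 2, ∀ k' ≤ 1, ∀ l' ≤ 1, shiftEval U c (X 0 ^ k * p) +
      shiftEval U c (X 1 ^ l * q) + shiftEval U c (X 0 ^ k' * (X 1 ^ l' * r)) ∈ T) :
    shiftEval U c (bary x (X 0) ^ 2 * p + bary y (X 1) ^ 2 * q +
      bary x (X 0) * (bary y (X 1) * r)) ∈ T := by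
  rw [map_add, map_add, ← pow_one (bary x (X 0)), ← pow_one (bary y (X 1)), ← pow_mul, ← pow_mul,
    one_mul]
  refine add_shiftEval_pow_mul_mem c hx hx' _ _ 1 _ fun k' hk' => ?_
  rw [mul_left_comm]
  refine add_shiftEval_pow_mul_mem c hy hy' _ _ 1 _ fun l' hl' => ?_
  rw [mul_left_comm, add_right_comm]
  refine add_shiftEval_pow_mul_mem c hy hy' _ _ 2 _ fun l hl => ?_
  rw [add_assoc, add_comm]
  refine add_shiftEval_pow_mul_mem c hx hx' _ _ 2 _ fun k hk => ?_
  convert h k hk l hl k' hk' l' hl' using 1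
  ring

/-- The second order part of the correlated average of `bernstein₂` is nonnegative. -/
lemma shiftEval_secondOrder_mem (hT : ∀ z : U, z ^ 2 ∈ T)
    {β ρ κ : ℝ} {M : ℕ} {c : ℕ → ℕ → ℝ}
    (hc : IsGridProfile β ρ κ M c) {x y : U} (hx : x ∈ T) (hx' : 1 - x ∈ T) (hy : y ∈ T)
    (hy' : 1 - y ∈ T) (a b : U) :
    shiftEval U c (bary x (X 0) ^ M * (bary y (X 1) ^ M *
      (bary x (X 0) ^ 2 * (C (((M + 2).choose 2 : U) * b ^ 2) * (X 1 - 1) ^ 2) +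
        bary y (X 1) ^ 2 * (C (((M + 2).choose 2 : U) * a ^ 2) * (X 0 - 1) ^ 2) +
        bary x (X 0) * (bary y (X 1) * (C (algebraMap ℝ U (ρ * ((M : ℝ) + 2) ^ 2) * (a * b)) *
          ((X 0 - 1) * (X 1 - 1))))))) ∈ T := by
  rw [← zero_add (shiftEval U c _)]
  refine add_shiftEval_pow_mul_mem c hx hx' 0 _ M _ fun i hi => ?_
  rw [mul_left_comm]
  refine add_shiftEval_pow_mul_mem c hy hy' 0 _ M _ fun j hj => ?_
  have e : ∀ p q r : MvPolynomial (Fin 2) U, X 1 ^ j * (X 0 ^ i * (bary x (X 0) ^ 2 * p +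
      bary y (X 1) ^ 2 * q + bary x (X 0) * (bary y (X 1) * r))) =
      bary x (X 0) ^ 2 * (X 0 ^ i * X 1 ^ j * p) + bary y (X 1) ^ 2 * (X 0 ^ i * X 1 ^ j * q) +
        bary x (X 0) * (bary y (X 1) * (X 0 ^ i * X 1 ^ j * r)) := fun p q r => by ring
  rw [zero_add, e]
  refine shiftEval_split_mem c hx hx' hy hy' _ _ _ fun k hk l hl k' hk' l' hl' => ?_
  obtain ⟨hA, hB, hD⟩ := hc.hessian i hi j hj k hk l hl k' hk' l' hl'
  have e₁ : (X 0 : MvPolynomial (Fin 2) U) ^ k *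
      (X 0 ^ i * X 1 ^ j * (C (((M + 2).choose 2 : U) * b ^ 2) * (X 1 - 1) ^ 2)) =
      C (((M + 2).choose 2 : U) * b ^ 2) * (X 0 ^ (i + k) * X 1 ^ (j + 2) -
        C 2 * (X 0 ^ (i + k) * X 1 ^ (j + 1)) + X 0 ^ (i + k) * X 1 ^ j) := by
    rw [map_ofNat]
    ring
  have e₂ : (X 1 : MvPolynomial (Fin 2) U) ^ l *
      (X 0 ^ i * X 1 ^ j * (C (((M + 2).choose 2 : U) * a ^ 2) * (X 0 - 1) ^ 2)) =
      C (((M + 2).choose 2 : U) * a ^ 2) * (X 0 ^ (i + 2) * X 1 ^ (j + l) -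
        C 2 * (X 0 ^ (i + 1) * X 1 ^ (j + l)) + X 0 ^ i * X 1 ^ (j + l)) := by
    rw [map_ofNat]
    ring
  have e₃ : (X 0 : MvPolynomial (Fin 2) U) ^ k' * (X 1 ^ l' * (X 0 ^ i * X 1 ^ j *
      (C (algebraMap ℝ U (ρ * ((M : ℝ) + 2) ^ 2) * (a * b)) * ((X 0 - 1) * (X 1 - 1))))) =
      C (algebraMap ℝ U (ρ * ((M : ℝ) + 2) ^ 2) * (a * b)) *
        (X 0 ^ (i + k' + 1) * X 1 ^ (j + l' + 1) - X 0 ^ (i + k' + 1) * X 1 ^ (j + l') -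
        X 0 ^ (i + k') * X 1 ^ (j + l' + 1) + X 0 ^ (i + k') * X 1 ^ (j + l')) := by
    ring
  rw [e₁, e₂, e₃]
  simp only [shiftEval_C_mul, map_add, map_sub, shiftEval_X_pow]
  have hch : (((M + 2).choose 2 : ℕ) : ℝ) = ((M : ℝ) + 2) * (M + 1) / 2 := by
    rw [Nat.cast_choose_two]
    push_cast
    ring
  have hch0 : (0 : ℝ) < ((M + 2).choose 2 : ℕ) := by
    rw [hch]
    positivity
  have key := quadForm_mem (T := T) hT (A := ((M + 2).choose 2 : ℕ) *
      (c (i + 2) (j + l) - 2 * c (i + 1) (j + l) + c i (j + l)))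
    (B := ((M + 2).choose 2 : ℕ) * (c (i + k) (j + 2) - 2 * c (i + k) (j + 1) + c (i + k) j))
    (H := ρ * ((M : ℝ) + 2) ^ 2 * (c (i + k' + 1) (j + l' + 1) - c (i + k' + 1) (j + l')
      - c (i + k') (j + l' + 1) + c (i + k') (j + l')) / 2) (mul_pos hch0 hA) ?_ a b
  · rw [mul_div_cancel₀ _ two_ne_zero] at key
    convert key using 1
    simp only [map_mul, map_add, map_sub, map_natCast, map_ofNat]
    ring
  · rw [hch]
    have := mul_le_mul_of_nonneg_left hD (show 0 ≤ ((M : ℝ) + 2) ^ 2 / 4 by positivity)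
    linarith

lemma isQuartic_of_mem {a b z : U} (hz : z ∈ T) : IsQuartic T a b z :=
  ⟨0, le_rfl, by simpa using hz⟩

/-- **Two-point inequality**: the average of the Bernstein polynomial of a grid profile over a
`ρ`-correlated pair of steps `(± a, ± b)` is bounded below by its central value, up to terms of
fourth order. -/
lemma isQuartic_bernstein₂_average (hT : ∀ z : U, z ^ 2 ∈ T)
    (hbd : ∀ z : U, ∃ K : ℝ, 0 ≤ K ∧ algebraMap ℝ U K - z ∈ T ∧ algebraMap ℝ U K + z ∈ T)
    {β ρ κ : ℝ} {M : ℕ} {c : ℕ → ℕ → ℝ}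
    (hc : IsGridProfile β ρ κ M c) {x y : U} (hx : x ∈ T) (hx' : 1 - x ∈ T) (hy : y ∈ T)
    (hy' : 1 - y ∈ T) (a b : U) : IsQuartic T a b
      ((1 + algebraMap ℝ U ρ) *
          (bernstein₂ (M + 2) c (x + a) (y + b) + bernstein₂ (M + 2) c (x - a) (y - b)) +
        (1 - algebraMap ℝ U ρ) *
          (bernstein₂ (M + 2) c (x + a) (y - b) + bernstein₂ (M + 2) c (x - a) (y + b)) -
        4 * bernstein₂ (M + 2) c x y) := by
  obtain ⟨r₁, s₁, h₁⟩ := exists_add_mul_pow_eq (bary x (X 0)) (X 0 - 1) (C a) M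
  obtain ⟨r₂, s₂, h₂⟩ := exists_add_mul_pow_eq (bary y (X 1)) (X 1 - 1) (C b) M
  have ha₁ : bary (x + a) (X 0) = bary x (X 0) + 1 * C a * (X 0 - 1) := by
    simp only [bary, map_sub, map_add]
    ring
  have ha₂ : bary (x - a) (X 0) = bary x (X 0) + (-1) * C a * (X 0 - 1) := by
    simp only [bary, map_sub]
    ring
  have hb₁ : bary (y + b) (X 1) = bary y (X 1) + 1 * C b * (X 1 - 1) := by
    simp only [bary, map_sub, map_add]
    ring
  have hb₂ : bary (y - b) (X 1) = bary y (X 1) + (-1) * C b * (X 1 - 1) := by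
    simp only [bary, map_sub]
    ring
  have hW := shiftEval_secondOrder_mem hT hc hx hx' hy hy' a b
  simp only [bernstein₂_eq_shiftEval, ha₁, ha₂, hb₁, hb₂, h₁ 1 (one_pow 2),
    h₂ 1 (one_pow 2), h₁ (-1) neg_one_sq, h₂ (-1) neg_one_sq]
  generalize bary x (X 0) = e₁ at *
  generalize bary y (X 1) = e₂ at *
  generalize (X 0 - 1 : MvPolynomial (Fin 2) U) = δ₁ at *
  generalize (X 1 - 1 : MvPolynomial (Fin 2) U) = δ₂ at *
  set N : U := (M : U) + 2 with hN
  set r : U := algebraMap ℝ U ρ with hr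
  set h : U := ((M + 2).choose 2 : U) with hh
  have hrN : algebraMap ℝ U (ρ * ((M : ℝ) + 2) ^ 2) = r * N ^ 2 := by
    rw [map_mul, map_pow, map_add, map_natCast, map_ofNat]
  rw [hrN] at hW
  have hNC : (M : MvPolynomial (Fin 2) U) + 2 = C N := by
    rw [hN, map_add, map_natCast, map_ofNat]
  have hhC : ((M + 2).choose 2 : MvPolynomial (Fin 2) U) = C h := by rw [hh, map_natCast]
  rw [hNC, hhC]
  clear_value N r h
  have lin : ∀ p q s t w, (1 + r) * (shiftEval U c p + shiftEval U c q) +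
      (1 - r) * (shiftEval U c s + shiftEval U c t) - 4 * shiftEval U c w =
      shiftEval U c (C (1 + r) * (p + q) + C (1 - r) * (s + t) - C 4 * w) := fun p q s t w => by
    rw [map_sub, map_add, shiftEval_C_mul, shiftEval_C_mul, shiftEval_C_mul,
      map_add (shiftEval U c) p, map_add (shiftEval U c) s]
  have lin' : ∀ w z₁ z₂ z₃ z₄ z₅, shiftEval U c (C 4 * (w + C (a ^ 4) * z₁ + C (b ^ 4) * z₂ +
      C (a ^ 2 * b ^ 2) * z₃ + C (a ^ 3 * b) * z₄ + C (b ^ 3 * a) * z₅)) =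
      4 * (shiftEval U c w + a ^ 4 * shiftEval U c z₁ + b ^ 4 * shiftEval U c z₂ +
        a ^ 2 * b ^ 2 * shiftEval U c z₃ + a ^ 3 * b * shiftEval U c z₄ +
        b ^ 3 * a * shiftEval U c z₅) := fun w z₁ z₂ z₃ z₄ z₅ => by
    rw [shiftEval_C_mul, map_add, map_add, map_add, map_add, map_add, shiftEval_C_mul,
      shiftEval_C_mul, shiftEval_C_mul, shiftEval_C_mul, shiftEval_C_mul]
  have key := lin' (e₁ ^ M * (e₂ ^ M * (e₁ ^ 2 * (C (h * b ^ 2) * δ₂ ^ 2) +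
      e₂ ^ 2 * (C (h * a ^ 2) * δ₁ ^ 2) + e₁ * (e₂ * (C (r * N ^ 2 * (a * b)) * (δ₁ * δ₂))))))
    (r₁ * (e₂ ^ (M + 2) + C h * C b ^ 2 * (e₂ ^ M * δ₂ ^ 2) + C b ^ 4 * r₂))
    ((e₁ ^ (M + 2) + C h * C a ^ 2 * (e₁ ^ M * δ₁ ^ 2)) * r₂)
    (C h ^ 2 * (e₁ ^ M * δ₁ ^ 2) * (e₂ ^ M * δ₂ ^ 2))
    (C r * s₁ * (C N * (e₂ ^ (M + 1) * δ₂) + C b ^ 2 * s₂))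
    (C r * C N * (e₁ ^ (M + 1) * δ₁) * s₂)
  have four : ∀ z : U, IsQuartic T a b z → IsQuartic T a b (4 * z) := fun z hz => by
    convert (hz.add hz).add (hz.add hz) using 1
    ring
  rw [lin]
  have h5 := fun z₁ z₂ z₃ z₄ z₅ => four _ ((((((isQuartic_of_mem hW).add
    (isQuartic_pow_four_mul hT hbd a b z₁)).add
    (isQuartic_pow_four_mul hT hbd b a z₂).swap).add (isQuartic_sq_mul_sq_mul hT hbd a b z₃)).add
    (isQuartic_cube_mul_mul hT hbd a b z₄)).add (isQuartic_cube_mul_mul hT hbd b a z₅).swap)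
  convert (congrArg (IsQuartic T a b) key).mpr (h5 _ _ _ _ _) using 2
  simp only [map_add, map_sub, map_mul, map_pow, map_one, map_ofNat]
  ring

lemma bernstein₂_add (N : ℕ) (c c' : ℕ → ℕ → ℝ) (x y : U) :
    bernstein₂ N (fun i j => c i j + c' i j) x y = bernstein₂ N c x y + bernstein₂ N c' x y := by
  simp only [bernstein₂, map_add, add_mul, Finset.sum_add_distrib]

lemma bernstein₂_const_mul (N : ℕ) (r : ℝ) (c : ℕ → ℕ → ℝ) (x y : U) :
    bernstein₂ N (fun i j => r * c i j) x y = algebraMap ℝ U r * bernstein₂ N c x y := by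
  simp only [bernstein₂, map_mul, Finset.mul_sum, mul_assoc]

lemma bernstein₂_mul (N : ℕ) (u v : ℕ → ℝ) (x y : U) : bernstein₂ N (fun i j => u i * v j) x y =
    (∑ i ∈ Finset.range (N + 1),
      algebraMap ℝ U (u i) * Polynomial.aeval x (bernsteinPolynomial ℝ N i)) *
    ∑ j ∈ Finset.range (N + 1),
      algebraMap ℝ U (v j) * Polynomial.aeval y (bernsteinPolynomial ℝ N j) := by
  simp only [bernstein₂, Finset.sum_mul_sum, map_mul, mul_mul_mul_comm]

lemma sum_aeval_bernstein (N : ℕ) (x : U) : ∑ i ∈ Finset.range (N + 1),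
    algebraMap ℝ U 1 * Polynomial.aeval x (bernsteinPolynomial ℝ N i) = 1 := by
  simp only [map_one, one_mul, ← map_sum, bernsteinPolynomial.sum]

lemma sum_div_mul_aeval_bernstein {N : ℕ} (hN : N ≠ 0) (x : U) : ∑ i ∈ Finset.range (N + 1),
    algebraMap ℝ U (i / N) * Polynomial.aeval x (bernsteinPolynomial ℝ N i) = x := by
  have h := congrArg (fun p => algebraMap ℝ U (1 / N) * Polynomial.aeval x p)
    (bernsteinPolynomial.sum_smul ℝ N)
  simp only [map_sum, Finset.mul_sum, Polynomial.aeval_X, nsmul_eq_mul, map_mul,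
    map_natCast] at h
  rw [← map_natCast (algebraMap ℝ U) N, ← mul_assoc, ← map_mul,
    one_div_mul_cancel (Nat.cast_ne_zero.2 hN), map_one, one_mul] at h
  refine Eq.trans ?_ h
  refine Finset.sum_congr rfl fun i _ => ?_
  rw [← mul_assoc, ← map_natCast (algebraMap ℝ U) i, ← map_mul, one_div_mul_eq_div]

lemma sum_div_sq_mul_aeval_bernstein {N : ℕ} (hN : N ≠ 0) (x : U) : ∑ i ∈ Finset.range (N + 1),
    algebraMap ℝ U ((i / N) ^ 2) * Polynomial.aeval x (bernsteinPolynomial ℝ N i) =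
      x ^ 2 + algebraMap ℝ U (1 / N) * (x * (1 - x)) := by
  have h := congrArg (fun p => algebraMap ℝ U (1 / N ^ 2) * Polynomial.aeval x p)
    (bernsteinPolynomial.sum_mul_smul ℝ N)
  simp only [map_sum, Finset.mul_sum, Polynomial.aeval_X_pow, nsmul_eq_mul, map_mul,
    map_natCast] at h
  have hN' : (N : ℝ) ≠ 0 := Nat.cast_ne_zero.2 hN
  have e : ∀ i ∈ Finset.range (N + 1),
      algebraMap ℝ U ((i / N) ^ 2) * Polynomial.aeval x (bernsteinPolynomial ℝ N i) =
      algebraMap ℝ U (1 / N ^ 2) * (((i * (i - 1) : ℕ) : U) *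
        Polynomial.aeval x (bernsteinPolynomial ℝ N i)) + algebraMap ℝ U (1 / N) *
        (algebraMap ℝ U (i / N) * Polynomial.aeval x (bernsteinPolynomial ℝ N i)) := fun i _ => by
    rw [← mul_assoc, ← mul_assoc, ← map_natCast (algebraMap ℝ U), ← map_mul, ← map_mul, ← add_mul,
      ← map_add]
    congr 2
    cases i with
    | zero => simp
    | succ i =>
      push_cast
      field_simp
  rw [Finset.sum_congr rfl e, Finset.sum_add_distrib, ← Finset.mul_sum, ← Finset.mul_sum,
    sum_div_mul_aeval_bernstein hN, Finset.mul_sum, h, ← map_natCast (algebraMap ℝ U),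
    ← mul_assoc, ← map_mul]
  have e' : (1 / (N : ℝ) ^ 2 * ((N * (N - 1) : ℕ) : ℝ)) = 1 - 1 / N := by
    rw [Nat.cast_mul, Nat.cast_pred (Nat.pos_of_ne_zero hN)]
    field_simp
  rw [e', map_sub, map_one]
  ring

lemma bernstein₂_one (N : ℕ) (x y : U) : bernstein₂ N (fun _ _ => 1) x y = 1 := by
  have h := bernstein₂_mul N (fun _ => 1) (fun _ => 1) x y
  rw [sum_aeval_bernstein, sum_aeval_bernstein, one_mul] at h
  simpa only [one_mul] using h

lemma bernstein₂_left (N : ℕ) (u : ℕ → ℝ) (x y : U) : bernstein₂ N (fun i _ => u i) x y =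
    ∑ i ∈ Finset.range (N + 1),
      algebraMap ℝ U (u i) * Polynomial.aeval x (bernsteinPolynomial ℝ N i) := by
  rw [← mul_one (∑ i ∈ _, _), ← sum_aeval_bernstein N y, ← bernstein₂_mul]
  simp only [mul_one]

lemma bernstein₂_right (N : ℕ) (v : ℕ → ℝ) (x y : U) : bernstein₂ N (fun _ j => v j) x y =
    ∑ j ∈ Finset.range (N + 1),
      algebraMap ℝ U (v j) * Polynomial.aeval y (bernsteinPolynomial ℝ N j) := by
  rw [← one_mul (∑ i ∈ _, _), ← sum_aeval_bernstein N x, ← bernstein₂_mul]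
  simp only [one_mul]

lemma aeval_bernstein_mem {N : ℕ} (i : ℕ) {x : U} (hx : x ∈ T) (hx' : 1 - x ∈ T) :
    Polynomial.aeval x (bernsteinPolynomial ℝ N i) ∈ T := by
  rw [aeval_bernstein]
  exact T.mul_mem (T.mul_mem (natCast_mem T _) (T.pow_mem hx _)) (T.pow_mem hx' _)

lemma bernstein₂_mem (hT : ∀ z : U, z ^ 2 ∈ T) {N : ℕ} {c : ℕ → ℕ → ℝ}
    (hc : ∀ i ≤ N, ∀ j ≤ N, 0 ≤ c i j) {x y : U} (hx : x ∈ T)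
    (hx' : 1 - x ∈ T) (hy : y ∈ T) (hy' : 1 - y ∈ T) : bernstein₂ N c x y ∈ T := by
  refine T.sum_mem fun i hi => T.sum_mem fun j hj => algebraMap_mul_mem hT ?_
    (T.mul_mem (aeval_bernstein_mem i hx hx') (aeval_bernstein_mem j hy hy'))
  rw [Finset.mem_range, Nat.lt_succ_iff] at hi hj
  exact hc i hi j hj

/-- A bilinear function that dominates `c` on the grid dominates its Bernstein polynomial. -/
lemma sub_bernstein₂_mem (hT : ∀ z : U, z ^ 2 ∈ T)
    {β ρ κ : ℝ} {M : ℕ} {c : ℕ → ℕ → ℝ}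
    (hc : IsGridProfile β ρ κ M c) {x y : U} (hx : x ∈ T) (hx' : 1 - x ∈ T) (hy : y ∈ T)
    (hy' : 1 - y ∈ T) :
    1 - x - y + 2 * x * y - bernstein₂ (M + 2) c x y + algebraMap ℝ U κ ∈ T := by
  have h := bernstein₂_mem hT (N := M + 2) (c := fun i j => (1 + κ) * 1 +
      ((-1) * (i / (M + 2 : ℕ)) + ((-1) * (j / (M + 2 : ℕ)) +
      (2 * (i / (M + 2 : ℕ) * (j / (M + 2 : ℕ))) + (-1) * c i j)))) ?_ hx hx' hy hy'
  · simp only [bernstein₂_add, bernstein₂_const_mul] at h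
    rw [bernstein₂_one, bernstein₂_left _ (fun i => (i : ℝ) / (M + 2 : ℕ)),
      bernstein₂_right _ (fun i => (i : ℝ) / (M + 2 : ℕ)),
      bernstein₂_mul _ (fun i => (i : ℝ) / (M + 2 : ℕ)) (fun i => (i : ℝ) / (M + 2 : ℕ)),
      sum_div_mul_aeval_bernstein (by lia),
      sum_div_mul_aeval_bernstein (by lia)] at h
    convert h using 1
    simp only [map_add, map_neg, map_one, map_ofNat]
    ring
  · intro i hi j hj
    have := hc.le_bilin i hi j hj
    push_cast
    linarith

lemma bernstein₂_self_sub_mem (hT : ∀ z : U, z ^ 2 ∈ T)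
    {β ρ κ : ℝ} {M : ℕ} {c : ℕ → ℕ → ℝ}
    (hc : IsGridProfile β ρ κ M c) {x : U} (hx : x ∈ T) (hx' : 1 - x ∈ T) :
    bernstein₂ (M + 2) c x x - algebraMap ℝ U (1 / 2 + β / Real.pi) + algebraMap ℝ U κ ∈ T := by
  have h := bernstein₂_mem hT (N := M + 2) (c := fun i j => (-(1 / 2 + β / Real.pi)) * 1 +
      (1 / 2 * (i / (M + 2 : ℕ)) ^ 2 + (1 / 2 * (j / (M + 2 : ℕ)) ^ 2 +
      ((-1) * (i / (M + 2 : ℕ) * (j / (M + 2 : ℕ))) + 1 * c i j)))) ?_ hx hx' hx hx'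
  · simp only [bernstein₂_add, bernstein₂_const_mul] at h
    rw [bernstein₂_one, bernstein₂_left _ (fun i => ((i : ℝ) / (M + 2 : ℕ)) ^ 2),
      bernstein₂_right _ (fun i => ((i : ℝ) / (M + 2 : ℕ)) ^ 2),
      bernstein₂_mul _ (fun i => (i : ℝ) / (M + 2 : ℕ)) (fun i => (i : ℝ) / (M + 2 : ℕ)),
      sum_div_sq_mul_aeval_bernstein (by lia),
      sum_div_mul_aeval_bernstein (by lia)] at h
    have hN : (0 : ℝ) < 1 / (M + 2 : ℕ) := by positivity
    have h2 := algebraMap_mul_mem hT hN.le (hT (x - algebraMap ℝ U (1 / 2)))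
    have h3 := algebraMap_mem_of_nonneg hT (r := κ - 1 / (M + 2 : ℕ) * (1 / 4)) (by
      have := hc.inv_le
      push_cast at hN ⊢
      linarith)
    have e1 : algebraMap ℝ U (1 / 4) = algebraMap ℝ U (1 / 2) ^ 2 := by
      rw [← map_pow]
      norm_num
    have e2 : 2 * algebraMap ℝ U (1 / 2) = 1 := by
      rw [← map_ofNat (algebraMap ℝ U) 2, ← map_mul]
      norm_num
    convert T.add_mem (T.add_mem h h2) h3 using 1
    simp only [map_add, map_neg, map_one, map_sub, map_mul, e1]
    linear_combination (-(x ^ 2) + algebraMap ℝ U (1 / (M + 2 : ℕ)) * (x ^ 2 - x) +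
      algebraMap ℝ U (1 / (M + 2 : ℕ)) * x) * e2
  · intro i hi j hj
    have := hc.le_near_diag i j
    push_cast
    linarith

end Bernstein

section Certificates

variable {σ : Type*}

lemma isSOS_of_fintype {ι : Type*} [Fintype ι] (s : ι → MvPolynomial σ ℝ) :
    IsSOS (∑ i, s i ^ 2) :=
  ⟨Fintype.card ι, s ∘ (Fintype.equivFin ι).symm,
    ((Fintype.equivFin ι).symm.sum_comp fun i => s i ^ 2).symm⟩

lemma IsSOS.mul {p q : MvPolynomial σ ℝ} (hp : IsSOS p) (hq : IsSOS q) : IsSOS (p * q) := by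
  obtain ⟨k, s, rfl⟩ := hp
  obtain ⟨l, t, rfl⟩ := hq
  convert isSOS_of_fintype fun i : Fin k × Fin l => s i.1 * t i.2 using 1
  rw [Finset.sum_mul_sum, Fintype.sum_prod_type]
  simp only [mul_pow]

lemma isSOS_sq (p : MvPolynomial σ ℝ) : IsSOS (p ^ 2) :=
  ⟨1, fun _ => p, by simp⟩

variable {A : Set (MvPolynomial σ ℝ)} {d e : ℕ} {p q : MvPolynomial σ ℝ}

lemma sosProofGe_of_fintype {ι : Type*} [Fintype ι] (q r : ι → MvPolynomial σ ℝ)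
    (hq : ∀ i, ∃ m : Multiset (MvPolynomial σ ℝ), (∀ a ∈ m, a ∈ A) ∧ q i = m.prod)
    (hr : ∀ i, IsSOS (r i)) (hd : ∀ i, (r i).totalDegree + (q i).totalDegree ≤ d) :
    SosProofGe A d (∑ i, r i * q i) :=
  ⟨Fintype.card ι, q ∘ (Fintype.equivFin ι).symm, r ∘ (Fintype.equivFin ι).symm,
    fun _ => hq _, fun _ => hr _, fun _ => hd _,
    ((Fintype.equivFin ι).symm.sum_comp fun i => r i * q i).symm⟩

lemma sosProofGe_zero : SosProofGe A d 0 :=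
  ⟨0, 0, 0, fun i => i.elim0, fun i => i.elim0, fun i => i.elim0, by simp⟩

lemma SosProofGe.mono (hp : SosProofGe A d p) (h : d ≤ e) : SosProofGe A e p := by
  obtain ⟨k, q, r, h₁, h₂, h₃, rfl⟩ := hp
  exact ⟨k, q, r, h₁, h₂, fun i => (h₃ i).trans h, rfl⟩

lemma SosProofGe.add (hp : SosProofGe A d p) (hq : SosProofGe A d q) :
    SosProofGe A d (p + q) := by
  obtain ⟨k, q₁, r₁, h₁, h₂, h₃, rfl⟩ := hp
  obtain ⟨l, q₂, r₂, h₁', h₂', h₃', rfl⟩ := hq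
  convert sosProofGe_of_fintype (Sum.elim q₁ q₂) (Sum.elim r₁ r₂) (Sum.forall.2 ⟨h₁, h₁'⟩)
    (Sum.forall.2 ⟨h₂, h₂'⟩) (Sum.forall.2 ⟨h₃, h₃'⟩) using 1
  simp

lemma SosProofGe.mul (hp : SosProofGe A d p) (hq : SosProofGe A e q) :
    SosProofGe A (d + e) (p * q) := by
  obtain ⟨k, q₁, r₁, h₁, h₂, h₃, rfl⟩ := hp
  obtain ⟨l, q₂, r₂, h₁', h₂', h₃', rfl⟩ := hq
  convert sosProofGe_of_fintype (fun i : Fin k × Fin l => q₁ i.1 * q₂ i.2)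
    (fun i => r₁ i.1 * r₂ i.2) (fun i => ?_) (fun i => (h₂ i.1).mul (h₂' i.2)) (fun i => ?_)
    using 1
  · rw [Finset.sum_mul_sum, Fintype.sum_prod_type]
    simp only [mul_mul_mul_comm]
  · obtain ⟨m, hm, e⟩ := h₁ i.1
    obtain ⟨m', hm', e'⟩ := h₁' i.2
    refine ⟨m + m', fun a ha => ?_, by rw [e, e', Multiset.prod_add]⟩
    rcases Multiset.mem_add.1 ha with h | h
    · exact hm a h
    · exact hm' a h
  · have := h₃ i.1
    have := h₃' i.2
    have := totalDegree_mul (r₁ i.1) (r₂ i.2)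
    have := totalDegree_mul (q₁ i.1) (q₂ i.2)
    lia

lemma SosProofGe.sum {ι : Type*} (s : Finset ι) {f : ι → MvPolynomial σ ℝ}
    (h : ∀ i ∈ s, SosProofGe A d (f i)) : SosProofGe A d (∑ i ∈ s, f i) :=
  Finset.sum_induction f (SosProofGe A d) (fun _ _ => SosProofGe.add) sosProofGe_zero h

lemma sosProofGe_sq (hp : p.totalDegree ≤ d) : SosProofGe A (2 * d) (p ^ 2) := by
  refine ⟨1, fun _ => 1, fun _ => p ^ 2, fun _ => ⟨0, by simp, by simp⟩, fun _ => isSOS_sq p,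
    fun _ => ?_, by simp⟩
  rw [totalDegree_one, add_zero]
  exact (totalDegree_pow _ _).trans (by gcongr)

lemma sosProofGe_C {r : ℝ} (hr : 0 ≤ r) : SosProofGe A d (C r : MvPolynomial σ ℝ) := by
  rw [← Real.sq_sqrt hr, map_pow]
  exact (sosProofGe_sq (d := 0) (totalDegree_C _).le).mono (by lia)

lemma SosProofGe.C_mul {r : ℝ} (hr : 0 ≤ r) (hp : SosProofGe A d p) :
    SosProofGe A d (C r * p) := by
  simpa using (sosProofGe_C (d := 0) hr).mul hp

lemma sosProofGe_of_mem (hp : p ∈ A) (hd : p.totalDegree ≤ d) : SosProofGe A d p := by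
  refine ⟨1, fun _ => p, fun _ => 1, fun _ => ⟨{p}, by simpa, by simp⟩, fun _ => ?_,
    fun _ => by simpa, by simp⟩
  simpa using isSOS_sq (1 : MvPolynomial σ ℝ)

/-- The polynomials of degree at most `1` with degree-`1` proofs that they take values in
`[0, 1]`. -/
structure IsUnitValued (A : Set (MvPolynomial σ ℝ)) (p : MvPolynomial σ ℝ) : Prop where
  totalDegree_le : p.totalDegree ≤ 1
  nonneg : SosProofGe A 1 p
  le_one : SosProofGe A 1 (1 - p)

lemma IsUnitValued.sum {ι : Type*} {s : Finset ι} {w : ι → ℝ} (hw : ∀ i ∈ s, 0 ≤ w i)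
    (hw' : ∑ i ∈ s, w i = 1) {f : ι → MvPolynomial σ ℝ} (h : ∀ i ∈ s, IsUnitValued A (f i)) :
    IsUnitValued A (∑ i ∈ s, C (w i) * f i) where
  totalDegree_le := totalDegree_finsetSum_le fun i hi => (totalDegree_mul _ _).trans <| by
    rw [totalDegree_C, zero_add]
    exact (h i hi).totalDegree_le
  nonneg := SosProofGe.sum s fun i hi => (h i hi).nonneg.C_mul (hw i hi)
  le_one := by
    have e : 1 - ∑ i ∈ s, C (w i) * f i = ∑ i ∈ s, C (w i) * (1 - f i) := by
      simp only [mul_sub, Finset.sum_sub_distrib, mul_one, ← map_sum, hw', map_one]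
    rw [e]
    exact SosProofGe.sum s fun i hi => (h i hi).le_one.C_mul (hw i hi)

end Certificates

section Transfer

/-- The constraints for a pair of symmetric steps `x ± a`, `y ± b` inside `[0, 1]`, where
`x, y, a, b` are the four indeterminates. -/
def stepConstraints : Set (MvPolynomial (Fin 4) ℝ) :=
  {p | p = X 0 + X 2 ∨ p = X 0 - X 2 ∨ p = X 1 + X 3 ∨ p = X 1 - X 3}

/-- The polynomials with a proof of nonnegativity, of any degree, from `stepConstraints` and
the squares. -/
def stepCone : Subsemiring (MvPolynomial (Fin 4) ℝ) :=
  Subsemiring.closure ({p | ∃ z, p = z ^ 2} ∪ {p | p ∈ stepConstraints ∨ 1 - p ∈ stepConstraints})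

lemma sq_mem_stepCone (z : MvPolynomial (Fin 4) ℝ) : z ^ 2 ∈ stepCone :=
  Subsemiring.subset_closure (.inl ⟨z, rfl⟩)

lemma mem_stepCone {p : MvPolynomial (Fin 4) ℝ} (hp : p ∈ stepConstraints) : p ∈ stepCone :=
  Subsemiring.subset_closure (.inr (.inl hp))

lemma one_sub_mem_stepCone {p : MvPolynomial (Fin 4) ℝ} (hp : p ∈ stepConstraints) :
    1 - p ∈ stepCone :=
  Subsemiring.subset_closure (.inr (.inr (by simpa using hp)))

/-- A point whose two translates by a step are `[0, 1]`-valued is itself `[0, 1]`-valued. -/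
lemma mem_of_add_sub_mem {x a : MvPolynomial (Fin 4) ℝ} (h₁ : x + a ∈ stepConstraints)
    (h₂ : x - a ∈ stepConstraints) : x ∈ stepCone ∧ 1 - x ∈ stepCone ∧
      1 - a ∈ stepCone ∧ 1 + a ∈ stepCone := by
  have h₃ := mem_stepCone h₁
  have h₄ := mem_stepCone h₂
  have h₅ := one_sub_mem_stepCone h₁
  have h₆ := one_sub_mem_stepCone h₂
  refine ⟨?_, ?_, ?_, ?_⟩ <;> refine mem_of_two_mul_mem sq_mem_stepCone ?_
  · convert add_mem h₃ h₄ using 1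
    ring
  · convert add_mem h₅ h₆ using 1
    ring
  · convert add_mem (add_mem h₅ h₄) (one_mem _) using 1
    ring
  · convert add_mem (add_mem h₆ h₃) (one_mem _) using 1
    ring

lemma exists_bound_stepCone (z : MvPolynomial (Fin 4) ℝ) : ∃ K : ℝ, 0 ≤ K ∧
    algebraMap ℝ _ K - z ∈ stepCone ∧ algebraMap ℝ _ K + z ∈ stepCone := by
  have hx := mem_of_add_sub_mem (x := X 0) (a := X 2) (.inl rfl) (.inr (.inl rfl))
  have hy := mem_of_add_sub_mem (x := X 1) (a := X 3) (.inr (.inr (.inl rfl)))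
    (.inr (.inr (.inr rfl)))
  induction z using MvPolynomial.induction_on with
  | C r =>
    refine ⟨|r|, abs_nonneg r, ?_, ?_⟩
    · rw [MvPolynomial.algebraMap_eq, ← map_sub, ← MvPolynomial.algebraMap_eq]
      exact algebraMap_mem_of_nonneg sq_mem_stepCone (by linarith [le_abs_self r])
    · rw [MvPolynomial.algebraMap_eq, ← map_add, ← MvPolynomial.algebraMap_eq]
      exact algebraMap_mem_of_nonneg sq_mem_stepCone (by linarith [neg_abs_le r])
  | add p q hp hq =>
    obtain ⟨K, hK, h₁, h₂⟩ := hp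
    obtain ⟨L, hL, h₃, h₄⟩ := hq
    refine ⟨K + L, add_nonneg hK hL, ?_, ?_⟩
    · convert add_mem h₁ h₃ using 1
      rw [map_add]
      ring
    · convert add_mem h₂ h₄ using 1
      rw [map_add]
      ring
  | mul_X p i hp =>
    obtain ⟨K, hK, h₁, h₂⟩ := hp
    have hX : 1 - X i ∈ stepCone ∧ 1 + X i ∈ stepCone := by
      fin_cases i
      · exact ⟨hx.2.1, add_mem (one_mem _) hx.1⟩
      · exact ⟨hy.2.1, add_mem (one_mem _) hy.1⟩
      · exact hx.2.2
      · exact hy.2.2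
    refine ⟨K, hK, ?_, ?_⟩ <;> refine mem_of_two_mul_mem sq_mem_stepCone ?_
    · convert add_mem (mul_mem h₁ hX.2) (mul_mem h₂ hX.1) using 1
      ring
    · convert add_mem (mul_mem h₁ hX.1) (mul_mem h₂ hX.2) using 1
      ring

/-- Assignments of linear forms to the four indeterminates that respect `stepConstraints`. -/
structure IsStep {σ : Type} (A : Set (MvPolynomial σ ℝ)) (φ : Fin 4 → MvPolynomial σ ℝ) :
    Prop where
  totalDegree_le : ∀ i, (φ i).totalDegree ≤ 1
  isUnitValued : ∀ p ∈ stepConstraints, IsUnitValued A (aeval φ p)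

lemma exists_totalDegree_aeval_le (z : MvPolynomial (Fin 4) ℝ) : ∃ D, ∀ {σ : Type}
    {φ : Fin 4 → MvPolynomial σ ℝ}, (∀ i, (φ i).totalDegree ≤ 1) →
    (aeval φ z).totalDegree ≤ D := by
  induction z using MvPolynomial.induction_on with
  | C r => exact ⟨0, fun _ => by simp [MvPolynomial.algebraMap_eq]⟩
  | add p q hp hq =>
    obtain ⟨D, hD⟩ := hp
    obtain ⟨E, hE⟩ := hq
    refine ⟨max D E, fun h => ?_⟩
    rw [map_add]
    exact (totalDegree_add _ _).trans (max_le_max (hD h) (hE h))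
  | mul_X p i hp =>
    obtain ⟨D, hD⟩ := hp
    refine ⟨D + 1, fun h => ?_⟩
    rw [map_mul, aeval_X]
    exact (totalDegree_mul _ _).trans (add_le_add (hD h) (h i))

/-- Membership in the cone yields proofs of uniformly bounded degree. -/
lemma exists_sosProofGe_aeval {z : MvPolynomial (Fin 4) ℝ} (hz : z ∈ stepCone) : ∃ D, ∀ {σ : Type}
    {A : Set (MvPolynomial σ ℝ)} {φ : Fin 4 → MvPolynomial σ ℝ}, IsStep A φ →
    SosProofGe A D (aeval φ z) := by
  induction hz using Subsemiring.closure_induction with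
  | mem z hz =>
    rcases hz with ⟨w, rfl⟩ | hz | hz
    · obtain ⟨D, hD⟩ := exists_totalDegree_aeval_le w
      refine ⟨2 * D, fun h => ?_⟩
      rw [map_pow]
      exact sosProofGe_sq (hD h.totalDegree_le)
    · exact ⟨1, fun h => (h.isUnitValued z hz).nonneg⟩
    · exact ⟨1, fun h => by simpa using (h.isUnitValued _ hz).le_one⟩
  | zero => exact ⟨0, fun _ => by simpa using sosProofGe_zero⟩
  | one => exact ⟨0, fun _ => by simpa using sosProofGe_C zero_le_one⟩
  | add p q _ _ hp hq =>
    obtain ⟨D, hD⟩ := hp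
    obtain ⟨E, hE⟩ := hq
    refine ⟨max D E, fun h => ?_⟩
    rw [map_add]
    exact ((hD h).mono (le_max_left _ _)).add ((hE h).mono (le_max_right _ _))
  | mul p q _ _ hp hq =>
    obtain ⟨D, hD⟩ := hp
    obtain ⟨E, hE⟩ := hq
    refine ⟨D + E, fun h => ?_⟩
    rw [map_mul]
    exact (hD h).mul (hE h)

variable {β ρ κ : ℝ} {M : ℕ} {c : ℕ → ℕ → ℝ}

lemma isStep_of_isUnitValued {σ : Type} {A : Set (MvPolynomial σ ℝ)}
    {x y a b : MvPolynomial σ ℝ} (ha : a.totalDegree ≤ 1) (hb : b.totalDegree ≤ 1)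
    (h₁ : IsUnitValued A (x + a)) (h₂ : IsUnitValued A (x - a))
    (h₃ : IsUnitValued A (y + b)) (h₄ : IsUnitValued A (y - b)) : IsStep A ![x, y, a, b] where
  totalDegree_le i := by
    have hx : x.totalDegree ≤ 1 := by
      simpa using (totalDegree_sub (x + a) a).trans (max_le h₁.totalDegree_le ha)
    have hy : y.totalDegree ≤ 1 := by
      simpa using (totalDegree_sub (y + b) b).trans (max_le h₃.totalDegree_le hb)
    fin_cases i
    exacts [hx, hy, ha, hb]
  isUnitValued := by
    rintro p (rfl | rfl | rfl | rfl) <;> simpa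

lemma exists_sosProofGe_bernstein₂_average (hc : IsGridProfile β ρ κ M c) : ∃ (D : ℕ) (K : ℝ),
    0 ≤ K ∧ ∀ {σ : Type} {A : Set (MvPolynomial σ ℝ)} {x y a b : MvPolynomial σ ℝ},
      a.totalDegree ≤ 1 → b.totalDegree ≤ 1 → IsUnitValued A (x + a) → IsUnitValued A (x - a) →
      IsUnitValued A (y + b) → IsUnitValued A (y - b) →
      SosProofGe A D (C K * (a ^ 4 + b ^ 4) + ((1 + C ρ) *
          (bernstein₂ (M + 2) c (x + a) (y + b) + bernstein₂ (M + 2) c (x - a) (y - b)) +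
        (1 - C ρ) *
          (bernstein₂ (M + 2) c (x + a) (y - b) + bernstein₂ (M + 2) c (x - a) (y + b)) -
        4 * bernstein₂ (M + 2) c x y)) := by
  have hx := mem_of_add_sub_mem (x := X 0) (a := X 2) (.inl rfl) (.inr (.inl rfl))
  have hy := mem_of_add_sub_mem (x := X 1) (a := X 3) (.inr (.inr (.inl rfl)))
    (.inr (.inr (.inr rfl)))
  obtain ⟨K, hK, hz⟩ := isQuartic_bernstein₂_average sq_mem_stepCone exists_bound_stepCone hc
    hx.1 hx.2.1 hy.1 hy.2.1 (X 2) (X 3)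
  obtain ⟨D, hD⟩ := exists_sosProofGe_aeval hz
  refine ⟨D, K, hK, fun ha hb h₁ h₂ h₃ h₄ => ?_⟩
  have h := hD (isStep_of_isUnitValued ha hb h₁ h₂ h₃ h₄)
  simp only [map_add, map_sub, map_mul, map_pow, map_one, map_ofNat, map_bernstein₂, aeval_X,
    AlgHom.commutes] at h
  simpa [MvPolynomial.algebraMap_eq] using h

lemma exists_sosProofGe_sub_bernstein₂ (hc : IsGridProfile β ρ κ M c) : ∃ D : ℕ,
    ∀ {σ : Type} {A : Set (MvPolynomial σ ℝ)} {x y : MvPolynomial σ ℝ},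
      IsUnitValued A x → IsUnitValued A y →
      SosProofGe A D (1 - x - y + 2 * x * y - bernstein₂ (M + 2) c x y + C κ) := by
  have hx := mem_of_add_sub_mem (x := X 0) (a := X 2) (.inl rfl) (.inr (.inl rfl))
  have hy := mem_of_add_sub_mem (x := X 1) (a := X 3) (.inr (.inr (.inl rfl)))
    (.inr (.inr (.inr rfl)))
  obtain ⟨D, hD⟩ := exists_sosProofGe_aeval
    (sub_bernstein₂_mem sq_mem_stepCone hc hx.1 hx.2.1 hy.1 hy.2.1)
  refine ⟨D, fun {σ A x y} h₁ h₃ => ?_⟩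
  have h := hD (isStep_of_isUnitValued (x := x) (y := y) (a := 0) (b := 0) (by simp) (by simp)
    (by simpa) (by simpa) (by simpa) (by simpa))
  simp only [map_add, map_sub, map_mul, map_one, map_ofNat, map_bernstein₂, aeval_X,
    AlgHom.commutes] at h
  simpa [MvPolynomial.algebraMap_eq] using h

lemma exists_sosProofGe_bernstein₂_self_sub (hc : IsGridProfile β ρ κ M c) : ∃ D : ℕ,
    ∀ {σ : Type} {A : Set (MvPolynomial σ ℝ)} {x : MvPolynomial σ ℝ}, IsUnitValued A x →
      SosProofGe A D (bernstein₂ (M + 2) c x x - C (1 / 2 + β / Real.pi) + C κ) := by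
  have hx := mem_of_add_sub_mem (x := X 0) (a := X 2) (.inl rfl) (.inr (.inl rfl))
  obtain ⟨D, hD⟩ := exists_sosProofGe_aeval
    (bernstein₂_self_sub_mem sq_mem_stepCone hc hx.1 hx.2.1)
  refine ⟨D, fun {σ A x} h₁ => ?_⟩
  have h := hD (isStep_of_isUnitValued (x := x) (y := x) (a := 0) (b := 0) (by simp) (by simp)
    (by simpa) (by simpa) (by simpa) (by simpa))
  rw [map_add, map_sub, map_bernstein₂, aeval_X, AlgHom.commutes, AlgHom.commutes] at h
  exact h

end Transfer

section Cube

variable {σ : Type*} {n : ℕ}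

/-- The average of a polynomial-valued function on the discrete cube. -/
def cubeAvg (g : (Fin n → Bool) → MvPolynomial σ ℝ) : MvPolynomial σ ℝ :=
  C ((2 : ℝ) ^ n)⁻¹ * ∑ x, g x

/-- The point of the cube obtained by changing the coordinate `i`. -/
def flipAt (i : Fin n) (x : Fin n → Bool) : Fin n → Bool := Function.update x i (!x i)

/-- Half the difference between the values at the endpoints of an edge in direction `i`. -/
def edgeDiff (i : Fin n) (g : (Fin n → Bool) → MvPolynomial σ ℝ) (x : Fin n → Bool) :
    MvPolynomial σ ℝ :=
  C (1 / 2) * (g x - g (flipAt i x))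

lemma flipAt_involutive (i : Fin n) : Function.Involutive (flipAt i) := fun x => by
  simp [flipAt]

lemma sum_flipAt {M : Type*} [AddCommMonoid M] (i : Fin n) (F : (Fin n → Bool) → M) :
    ∑ x, F (flipAt i x) = ∑ x, F x :=
  Equiv.sum_comp (flipAt_involutive i).toPerm F

lemma sum_cons {M : Type*} [AddCommMonoid M] (F : (Fin (n + 1) → Bool) → M) :
    ∑ x, F x = ∑ b, ∑ x, F (Fin.cons b x) := by
  rw [← (Fin.consEquiv fun _ => Bool).sum_comp, Fintype.sum_prod_type]
  rfl

lemma cubeAvg_cons (g : (Fin (n + 1) → Bool) → MvPolynomial σ ℝ) : cubeAvg g =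
    C (1 / 2) * (cubeAvg (fun x => g (Fin.cons true x)) +
      cubeAvg (fun x => g (Fin.cons false x))) := by
  rw [cubeAvg, sum_cons, Fintype.sum_bool, pow_succ', mul_inv, C_mul, cubeAvg, cubeAvg]
  rw [one_div]
  ring

lemma cubeAvg_add (g h : (Fin n → Bool) → MvPolynomial σ ℝ) :
    cubeAvg (fun x => g x + h x) = cubeAvg g + cubeAvg h := by
  simp only [cubeAvg, Finset.sum_add_distrib, mul_add]

lemma cubeAvg_sub (g h : (Fin n → Bool) → MvPolynomial σ ℝ) :
    cubeAvg (fun x => g x - h x) = cubeAvg g - cubeAvg h := by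
  simp only [cubeAvg, Finset.sum_sub_distrib, mul_sub]

lemma cubeAvg_mul_left (p : MvPolynomial σ ℝ) (g : (Fin n → Bool) → MvPolynomial σ ℝ) :
    cubeAvg (fun x => p * g x) = p * cubeAvg g := by
  simp only [cubeAvg, ← Finset.mul_sum]
  ring

lemma cubeAvg_const (p : MvPolynomial σ ℝ) : cubeAvg (fun _ : Fin n → Bool => p) = p := by
  have h : (C ((2 : ℝ) ^ n)⁻¹ * 2 ^ n : MvPolynomial σ ℝ) = 1 := by
    rw [← map_ofNat C 2, ← map_pow, ← map_mul, inv_mul_cancel₀ (by positivity), map_one]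
  rw [cubeAvg, Finset.sum_const, nsmul_eq_mul]
  simp [← mul_assoc, h]

lemma cubeAvg_flipAt (i : Fin n) (g : (Fin n → Bool) → MvPolynomial σ ℝ) :
    cubeAvg (fun x => g (flipAt i x)) = cubeAvg g := by
  rw [cubeAvg, sum_flipAt, cubeAvg]

lemma cubeAvg_sum {ι : Type*} (s : Finset ι) (g : ι → (Fin n → Bool) → MvPolynomial σ ℝ) :
    cubeAvg (fun x => ∑ i ∈ s, g i x) = ∑ i ∈ s, cubeAvg (g i) := by
  simp only [cubeAvg, Finset.mul_sum]
  exact Finset.sum_comm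

variable {A : Set (MvPolynomial σ ℝ)} {d : ℕ}

lemma SosProofGe.cubeAvg {g : (Fin n → Bool) → MvPolynomial σ ℝ}
    (h : ∀ x, SosProofGe A d (g x)) : SosProofGe A d (cubeAvg g) :=
  (SosProofGe.sum _ fun x _ => h x).C_mul (by positivity)

lemma IsUnitValued.cubeAvg {g : (Fin n → Bool) → MvPolynomial σ ℝ}
    (h : ∀ x, IsUnitValued A (g x)) : IsUnitValued A (cubeAvg g) := by
  rw [DMN.cubeAvg, Finset.mul_sum]
  exact IsUnitValued.sum (fun _ _ => by positivity) (by simp) fun x _ => h x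

lemma totalDegree_cubeAvg_le {g : (Fin n → Bool) → MvPolynomial σ ℝ}
    (h : ∀ x, (g x).totalDegree ≤ d) : (cubeAvg g).totalDegree ≤ d :=
  (totalDegree_mul _ _).trans <| by
    rw [totalDegree_C, zero_add]
    exact totalDegree_finsetSum_le fun x _ => h x

/-- Jensen's inequality for the fourth power. -/
lemma sosProofGe_cubeAvg_pow_four_sub {g : (Fin n → Bool) → MvPolynomial σ ℝ}
    (h : ∀ x, (g x).totalDegree ≤ 1) :
    SosProofGe A 4 (cubeAvg (fun x => g x ^ 4) - cubeAvg g ^ 4) := by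
  have hm := totalDegree_cubeAvg_le h
  have e : cubeAvg (fun x => g x ^ 4) - cubeAvg g ^ 4 = cubeAvg fun x =>
      ((g x - cubeAvg g) * (g x + cubeAvg g)) ^ 2 + C 2 * ((g x - cubeAvg g) * cubeAvg g) ^ 2 := by
    generalize hp : cubeAvg g = p
    have : ∀ x, ((g x - p) * (g x + p)) ^ 2 + C 2 * ((g x - p) * p) ^ 2 =
        g x ^ 4 - (p ^ 3 * (4 * g x) - 3 * p ^ 4) := fun x => by
      rw [map_ofNat]
      ring
    simp only [this, cubeAvg_sub, cubeAvg_mul_left, cubeAvg_const, hp]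
    ring
  rw [e]
  have h₁ : ∀ x, (g x - cubeAvg g).totalDegree ≤ 1 := fun x =>
    (totalDegree_sub _ _).trans (max_le (h x) hm)
  have h₂ : ∀ x, (g x + cubeAvg g).totalDegree ≤ 1 := fun x =>
    (totalDegree_add _ _).trans (max_le (h x) hm)
  exact SosProofGe.cubeAvg fun x =>
    (sosProofGe_sq (d := 2) ((totalDegree_mul _ _).trans (add_le_add (h₁ x) (h₂ x)))).add
    ((sosProofGe_sq (d := 2) ((totalDegree_mul _ _).trans (add_le_add (h₁ x) hm))).C_mul
      zero_le_two)

lemma corrWeight_cons (ρ : ℝ) (b b' : Bool) (x y : Fin n → Bool) :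
    corrWeight ρ (Fin.cons b x : Fin (n + 1) → Bool) (Fin.cons b' y) =
      (1 + ρ * sgn b * sgn b') / 4 * corrWeight ρ x y := by
  simp only [corrWeight, Fin.prod_univ_succ, Fin.cons_zero, Fin.cons_succ]

lemma corrWeight_nonneg {ρ : ℝ} (hρ : |ρ| ≤ 1) (x y : Fin n → Bool) : 0 ≤ corrWeight ρ x y := by
  obtain ⟨h₁, h₂⟩ := abs_le.1 hρ
  refine Finset.prod_nonneg fun i _ => ?_
  unfold sgn
  split_ifs <;> linarith

/-- The product rule for sums over the cube. -/
lemma sum_prod_bool (F : Fin n → Bool → ℝ) :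
    ∑ x : Fin n → Bool, ∏ i, F i (x i) = ∏ i, (F i true + F i false) := by
  have h := Finset.prod_univ_sum (fun _ : Fin n => (Finset.univ : Finset Bool)) F
  rw [Fintype.piFinset_univ] at h
  rw [← h]
  simp

lemma sum_corrWeight_mul (ρ τ : ℝ) (x z : Fin n → Bool) :
    ∑ y, 2 ^ n * corrWeight ρ x y * corrWeight τ y z = corrWeight (ρ * τ) x z := by
  have h : ∀ y, (2 : ℝ) ^ n * corrWeight ρ x y * corrWeight τ y z = ∏ i,
      (2 * ((1 + ρ * sgn (x i) * sgn (y i)) / 4) * ((1 + τ * sgn (y i) * sgn (z i)) / 4)) :=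
    fun y => by
      rw [Finset.prod_mul_distrib, Finset.prod_mul_distrib, Finset.prod_const, Finset.card_univ,
        Fintype.card_fin, corrWeight, corrWeight]
  rw [Finset.sum_congr rfl fun y _ => h y, sum_prod_bool fun i b => 2 *
    ((1 + ρ * sgn (x i) * sgn b) / 4) * ((1 + τ * sgn b * sgn (z i)) / 4), corrWeight]
  refine Finset.prod_congr rfl fun i _ => ?_
  simp only [sgn, if_true, Bool.false_eq_true, if_false]
  ring

lemma sum_corrWeight (ρ : ℝ) (x : Fin n → Bool) : ∑ y, 2 ^ n * corrWeight ρ x y = 1 := by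
  have h : ∀ y, (2 : ℝ) ^ n * corrWeight ρ x y = ∏ i,
      (2 * ((1 + ρ * sgn (x i) * sgn (y i)) / 4)) := fun y => by
    rw [Finset.prod_mul_distrib, Finset.prod_const, Finset.card_univ, Fintype.card_fin, corrWeight]
  rw [Finset.sum_congr rfl fun y _ => h y, sum_prod_bool fun i b => 2 *
    ((1 + ρ * sgn (x i) * sgn b) / 4)]
  refine Finset.prod_eq_one fun i _ => ?_
  simp only [sgn, if_true, Bool.false_eq_true, if_false]
  ring

lemma corrWeight_comm (ρ : ℝ) (x y : Fin n → Bool) : corrWeight ρ x y = corrWeight ρ y x := by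
  simp only [corrWeight, mul_right_comm]

lemma sum_sum_corrWeight (ρ : ℝ) : ∑ x : Fin n → Bool, ∑ y, corrWeight ρ x y = 1 := by
  have h : ∀ x : Fin n → Bool, ∑ y, corrWeight ρ x y = ((2 : ℝ) ^ n)⁻¹ := fun x => by
    refine eq_inv_of_mul_eq_one_right ?_
    rw [Finset.mul_sum, sum_corrWeight]
  simp [h]

lemma edgeDiff_cons_succ (i : Fin n) (g : (Fin (n + 1) → Bool) → MvPolynomial σ ℝ) (b : Bool)
    (x : Fin n → Bool) : edgeDiff i.succ g (Fin.cons b x) =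
      edgeDiff i (fun x => g (Fin.cons b x)) x := by
  simp [edgeDiff, flipAt, Fin.cons_update]

lemma edgeDiff_cons_zero_pow_four (g : (Fin (n + 1) → Bool) → MvPolynomial σ ℝ) (b : Bool)
    (x : Fin n → Bool) : edgeDiff 0 g (Fin.cons b x) ^ 4 =
      (C (1 / 2) * (g (Fin.cons true x) - g (Fin.cons false x))) ^ 4 := by
  cases b
  · simp only [edgeDiff, flipAt, Fin.cons_zero, Bool.not_false, Fin.update_cons_zero]
    ring
  · simp only [edgeDiff, flipAt, Fin.cons_zero, Bool.not_true, Fin.update_cons_zero]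

/-- **Invariance**: a two-point inequality for a bivariate function tensorizes to the cube. -/
lemma sosProofGe_corr_tensor {ρ K : ℝ} (hρ : |ρ| ≤ 1) (hK : 0 ≤ K) (hd : 4 ≤ d)
    {P : MvPolynomial σ ℝ → MvPolynomial σ ℝ → MvPolynomial σ ℝ}
    (hP : ∀ {x y a b : MvPolynomial σ ℝ}, a.totalDegree ≤ 1 → b.totalDegree ≤ 1 →
      IsUnitValued A (x + a) → IsUnitValued A (x - a) →
      IsUnitValued A (y + b) → IsUnitValued A (y - b) →
      SosProofGe A d (C K * (a ^ 4 + b ^ 4) +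
        ((1 + C ρ) * (P (x + a) (y + b) + P (x - a) (y - b)) +
        (1 - C ρ) * (P (x + a) (y - b) + P (x - a) (y + b)) - 4 * P x y)))
    {g h : (Fin n → Bool) → MvPolynomial σ ℝ} (hg : ∀ x, IsUnitValued A (g x))
    (hh : ∀ x, IsUnitValued A (h x)) :
    SosProofGe A d ((∑ x, ∑ y, C (corrWeight ρ x y) * P (g x) (h y)) - P (cubeAvg g) (cubeAvg h) +
      C K * ∑ i, (cubeAvg (fun x => edgeDiff i g x ^ 4) +
        cubeAvg (fun x => edgeDiff i h x ^ 4))) := by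
  induction n with
  | zero =>
    convert sosProofGe_zero using 1
    simp [cubeAvg, corrWeight]
  | succ n ih =>
    have hsplit : ∀ {q : (Fin (n + 1) → Bool) → MvPolynomial σ ℝ}, (∀ x, IsUnitValued A (q x)) →
        ∃ a : MvPolynomial σ ℝ, a.totalDegree ≤ 1 ∧
          cubeAvg (fun x => q (Fin.cons true x)) = cubeAvg q + a ∧
          cubeAvg (fun x => q (Fin.cons false x)) = cubeAvg q - a ∧
          SosProofGe A d (cubeAvg (fun x => edgeDiff 0 q x ^ 4) - a ^ 4) := by
      intro q hq
      have e2 : (C (1 / 2) * 2 : MvPolynomial σ ℝ) = 1 := by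
        rw [← map_ofNat C 2, ← map_mul]
        norm_num
      have hdeg : ∀ x : Fin n → Bool,
          (C (1 / 2) * (q (Fin.cons true x) - q (Fin.cons false x))).totalDegree ≤ 1 := fun x =>
        (totalDegree_mul _ _).trans <| by
          rw [totalDegree_C, zero_add]
          exact (totalDegree_sub _ _).trans
            (max_le (hq _).totalDegree_le (hq _).totalDegree_le)
      refine ⟨cubeAvg fun x => C (1 / 2) * (q (Fin.cons true x) - q (Fin.cons false x)),
        totalDegree_cubeAvg_le hdeg, ?_, ?_, ?_⟩
      · rw [cubeAvg_mul_left, cubeAvg_sub, cubeAvg_cons]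
        linear_combination (-cubeAvg (fun x => q (Fin.cons true x))) * e2
      · rw [cubeAvg_mul_left, cubeAvg_sub, cubeAvg_cons]
        linear_combination (-cubeAvg (fun x => q (Fin.cons false x))) * e2
      · convert (sosProofGe_cubeAvg_pow_four_sub (A := A) hdeg).mono hd using 2
        rw [cubeAvg_cons]
        simp only [edgeDiff_cons_zero_pow_four]
        linear_combination (cubeAvg fun x => (C (1 / 2) * (q (Fin.cons true x) -
          q (Fin.cons false x))) ^ 4) * e2
    obtain ⟨a, ha, ha₁, ha₂, ha₃⟩ := hsplit hg
    obtain ⟨b, hb, hb₁, hb₂, hb₃⟩ := hsplit hh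
    have hEg : ∀ s, IsUnitValued A (cubeAvg fun x => g (Fin.cons s x)) := fun s =>
      IsUnitValued.cubeAvg fun x => hg _
    have hEh : ∀ s, IsUnitValued A (cubeAvg fun x => h (Fin.cons s x)) := fun s =>
      IsUnitValued.cubeAvg fun x => hh _
    have key := hP ha hb (ha₁ ▸ hEg true) (ha₂ ▸ hEg false) (hb₁ ▸ hEh true) (hb₂ ▸ hEh false)
    have ih' := fun s t => ih (g := fun x => g (Fin.cons s x)) (h := fun x => h (Fin.cons t x))
      (fun x => hg _) (fun x => hh _)
    obtain ⟨hρ₁, hρ₂⟩ := abs_le.1 hρ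
    have s₁ := ((ih' true true).add (ih' false false)).C_mul (r := (1 + ρ) / 4) (by linarith)
    have s₂ := ((ih' true false).add (ih' false true)).C_mul (r := (1 - ρ) / 4) (by linarith)
    have s₃ := key.C_mul (r := 1 / 4) (by norm_num)
    have s₄ := (ha₃.add hb₃).C_mul hK
    have s₅ := ((sosProofGe_sq (A := A) (d := 2) ((totalDegree_pow a 2).trans (by lia))).add
      (sosProofGe_sq (A := A) (d := 2) ((totalDegree_pow b 2).trans (by lia)))).C_mul
      (r := K * (3 / 4)) (by positivity)
    convert (((s₁.add s₂).add s₃).add s₄).add (s₅.mono hd) using 1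
    have e4 : (C (1 / 4) * 4 : MvPolynomial σ ℝ) = 1 := by
      rw [← map_ofNat C 4, ← map_mul]
      norm_num
    have e₁ : C ((1 + ρ) / 4) = (C (1 / 4) * (1 + C ρ) : MvPolynomial σ ℝ) := by
      rw [← C_1, ← C_add, ← C_mul]
      ring_nf
    have e₂ : C ((1 - ρ) / 4) = (C (1 / 4) * (1 - C ρ) : MvPolynomial σ ℝ) := by
      rw [← C_1, ← C_sub, ← C_mul]
      ring_nf
    have e₃ : C (1 / 2) = (C (1 / 4) * 2 : MvPolynomial σ ℝ) := by
      rw [← map_ofNat C 2, ← C_mul]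
      norm_num
    have e₅ : C (K * (3 / 4)) = (C K * C (1 / 4) * 3 : MvPolynomial σ ℝ) := by
      rw [← map_ofNat C 3, ← C_mul, ← C_mul]
      ring_nf
    have hsum : ∑ x, ∑ y, C (corrWeight ρ x y) * P (g x) (h y) = ∑ s, ∑ t,
        C ((1 + ρ * sgn s * sgn t) / 4) * ∑ x, ∑ y, C (corrWeight ρ x y) *
          P (g (Fin.cons s x)) (h (Fin.cons t y)) := by
      rw [sum_cons]
      refine Finset.sum_congr rfl fun s _ => ?_
      simp only [sum_cons fun y => C (corrWeight ρ (Fin.cons s _) y) * P (g (Fin.cons s _)) (h y),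
        corrWeight_cons]
      rw [Finset.sum_comm]
      simp only [Finset.mul_sum, C_mul, mul_assoc]
    rw [hsum, Fin.sum_univ_succ]
    simp only [cubeAvg_cons (fun x => edgeDiff (Fin.succ _) _ x ^ 4), edgeDiff_cons_succ,
      Fintype.sum_bool, Finset.sum_add_distrib, ← Finset.mul_sum, ha₁, ha₂, hb₁, hb₂]
    have t₁ : (1 + ρ * sgn true * sgn true) / 4 = (1 + ρ) / 4 := by simp [sgn]
    have t₂ : (1 + ρ * sgn true * sgn false) / 4 = (1 - ρ) / 4 := by simp [sgn]; ring
    have t₃ : (1 + ρ * sgn false * sgn true) / 4 = (1 - ρ) / 4 := by simp [sgn]; ring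
    have t₄ : (1 + ρ * sgn false * sgn false) / 4 = (1 + ρ) / 4 := by simp [sgn]
    rw [t₁, t₂, t₃, t₄, e₁, e₂, e₃, e₅]
    linear_combination (P (cubeAvg g) (cubeAvg h) - C K * (a ^ 4 + b ^ 4)) * e4

end Cube

section Fourier

variable {σ : Type*} {n : ℕ}

lemma sgn_sq (b : Bool) : sgn b ^ 2 = 1 := by
  cases b <;> simp [sgn]

lemma sgn_not (b : Bool) : sgn (!b) = -sgn b := by
  cases b <;> simp [sgn]

lemma chi_insert {i : Fin n} {S : Finset (Fin n)} (hi : i ∉ S) (x : Fin n → Bool) :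
    chi (insert i S) x = sgn (x i) * chi S x :=
  Finset.prod_insert hi

lemma chi_flipAt_of_notMem {i : Fin n} {S : Finset (Fin n)} (hi : i ∉ S) (x : Fin n → Bool) :
    chi S (flipAt i x) = chi S x :=
  Finset.prod_congr rfl fun j hj => by
    rw [flipAt, Function.update_of_ne (ne_of_mem_of_not_mem hj hi)]

lemma chi_flipAt_of_mem {i : Fin n} {S : Finset (Fin n)} (hi : i ∈ S) (x : Fin n → Bool) :
    chi S (flipAt i x) = -chi S x := by
  rw [← Finset.insert_erase hi, chi_insert (Finset.notMem_erase i S),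
    chi_insert (Finset.notMem_erase i S), chi_flipAt_of_notMem (Finset.notMem_erase i S)]
  simp [flipAt, sgn_not]

/-- The function on the cube whose Fourier coefficients are `c S` for `S ⊆ I`. -/
def fourierSum (I : Finset (Fin n)) (c : Finset (Fin n) → MvPolynomial σ ℝ) (x : Fin n → Bool) :
    MvPolynomial σ ℝ :=
  ∑ S ∈ I.powerset, C (chi S x) * c S

lemma fourierSum_empty (c : Finset (Fin n) → MvPolynomial σ ℝ) (x : Fin n → Bool) :
    fourierSum ∅ c x = c ∅ := by
  simp [fourierSum, chi]

lemma fourierSum_insert {i : Fin n} {I : Finset (Fin n)} (hi : i ∉ I)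
    (c : Finset (Fin n) → MvPolynomial σ ℝ) (x : Fin n → Bool) :
    fourierSum (insert i I) c x =
      fourierSum I c x + C (sgn (x i)) * fourierSum I (fun S => c (insert i S)) x := by
  rw [fourierSum, Finset.sum_powerset_insert hi, fourierSum, fourierSum, Finset.mul_sum]
  congr 1
  refine Finset.sum_congr rfl fun S hS => ?_
  rw [chi_insert fun h => hi (Finset.mem_powerset.1 hS h), C_mul, mul_assoc]

lemma fourierSum_flipAt {i : Fin n} {I : Finset (Fin n)} (hi : i ∉ I)
    (c : Finset (Fin n) → MvPolynomial σ ℝ) (x : Fin n → Bool) :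
    fourierSum I c (flipAt i x) = fourierSum I c x :=
  Finset.sum_congr rfl fun S hS => by
    rw [chi_flipAt_of_notMem fun h => hi (Finset.mem_powerset.1 hS h)]

lemma totalDegree_fourierSum_le {d : ℕ} {c : Finset (Fin n) → MvPolynomial σ ℝ}
    (hc : ∀ S, (c S).totalDegree ≤ d) (I : Finset (Fin n)) (x : Fin n → Bool) :
    (fourierSum I c x).totalDegree ≤ d :=
  totalDegree_finsetSum_le fun S _ => (totalDegree_mul _ _).trans <| by
    rw [totalDegree_C, zero_add]
    exact hc S

lemma C_sgn_sq (b : Bool) : (C (sgn b) ^ 2 : MvPolynomial σ ℝ) = 1 := by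
  rw [← C_pow, sgn_sq, C_1]

lemma eq_of_two_mul_eq {p q : MvPolynomial σ ℝ} (h : 2 * p = 2 * q) : p = q :=
  mul_left_cancel₀ two_ne_zero h

/-- Symmetrizing an average under a coordinate flip. -/
lemma two_mul_cubeAvg (i : Fin n) (g : (Fin n → Bool) → MvPolynomial σ ℝ) :
    2 * cubeAvg g = cubeAvg fun x => g x + g (flipAt i x) := by
  rw [cubeAvg_add, cubeAvg_flipAt, two_mul]

/-- **Parseval's identity**. -/
lemma cubeAvg_fourierSum_sq (I : Finset (Fin n)) (c : Finset (Fin n) → MvPolynomial σ ℝ) :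
    cubeAvg (fun x => fourierSum I c x ^ 2) = ∑ S ∈ I.powerset, c S ^ 2 := by
  induction I using Finset.induction_on generalizing c with
  | empty => simp [fourierSum_empty, cubeAvg_const]
  | insert i I hi ih =>
    rw [Finset.sum_powerset_insert hi, ← ih, ← ih fun S => c (insert i S), ← cubeAvg_add]
    refine eq_of_two_mul_eq ?_
    rw [two_mul_cubeAvg i, ← cubeAvg_mul_left]
    congr 1
    funext x
    simp only [fourierSum_insert hi, fourierSum_flipAt hi]
    rw [show flipAt i x i = !x i by simp [flipAt], sgn_not, C_neg]
    linear_combination 2 * fourierSum I (fun S => c (insert i S)) x ^ 2 *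
      C_sgn_sq (σ := σ) (x i)

variable {A : Set (MvPolynomial σ ℝ)}

lemma sosProofGe_sum_C_mul_sq {c : Finset (Fin n) → MvPolynomial σ ℝ}
    (hc : ∀ S, (c S).totalDegree ≤ 1) {w : Finset (Fin n) → ℝ} (s : Finset (Finset (Fin n)))
    (hw : ∀ S ∈ s, 0 ≤ w S) : SosProofGe A 2 (∑ S ∈ s, C (w S) * c S ^ 2) :=
  SosProofGe.sum _ fun S hS => (sosProofGe_sq (d := 1) (hc S)).C_mul (hw S hS)

/-- **Hypercontractivity** for a pair of functions with linear Fourier coefficients. -/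
lemma sosProofGe_hypercontractive (I : Finset (Fin n)) {c e : Finset (Fin n) → MvPolynomial σ ℝ}
    (hc : ∀ S, (c S).totalDegree ≤ 1) (he : ∀ S, (e S).totalDegree ≤ 1) : SosProofGe A 4
      ((∑ S ∈ I.powerset, C (3 ^ S.card) * c S ^ 2) * (∑ S ∈ I.powerset, C (3 ^ S.card) * e S ^ 2) -
        cubeAvg fun x => (fourierSum I c x * fourierSum I e x) ^ 2) := by
  induction I using Finset.induction_on generalizing c e with
  | empty =>
    convert sosProofGe_zero using 1
    simp [fourierSum_empty, cubeAvg_const, mul_pow]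
  | insert i I hi ih =>
    have hc' : ∀ S, (c (insert i S)).totalDegree ≤ 1 := fun S => hc _
    have he' : ∀ S, (e (insert i S)).totalDegree ≤ 1 := fun S => he _
    have hsplit : ∀ c : Finset (Fin n) → MvPolynomial σ ℝ,
        ∑ S ∈ (insert i I).powerset, C (3 ^ S.card) * c S ^ 2 =
        ∑ S ∈ I.powerset, C (3 ^ S.card) * c S ^ 2 +
          3 * ∑ S ∈ I.powerset, C (3 ^ S.card) * c (insert i S) ^ 2 := fun c => by
      rw [Finset.sum_powerset_insert hi, Finset.mul_sum]
      congr 1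
      refine Finset.sum_congr rfl fun S hS => ?_
      rw [Finset.card_insert_of_notMem fun h => hi (Finset.mem_powerset.1 hS h), pow_succ', C_mul,
        map_ofNat, mul_assoc]
    have hpos : ∀ {c : Finset (Fin n) → MvPolynomial σ ℝ}, (∀ S, (c S).totalDegree ≤ 1) →
        SosProofGe A 2 (∑ S ∈ I.powerset, C (3 ^ S.card) * c S ^ 2) := fun hc =>
      sosProofGe_sum_C_mul_sq hc _ fun S _ => by positivity
    have havg : 2 * cubeAvg (fun x => (fourierSum (insert i I) c x *
        fourierSum (insert i I) e x) ^ 2) = cubeAvg fun x =>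
        2 * (fourierSum I c x * fourierSum I e x) ^ 2 +
        2 * (fourierSum I (fun S => c (insert i S)) x *
          fourierSum I (fun S => e (insert i S)) x) ^ 2 +
        6 * (fourierSum I c x * fourierSum I (fun S => e (insert i S)) x) ^ 2 +
        6 * (fourierSum I (fun S => c (insert i S)) x * fourierSum I e x) ^ 2 -
        4 * (fourierSum I c x * fourierSum I (fun S => e (insert i S)) x -
          fourierSum I (fun S => c (insert i S)) x * fourierSum I e x) ^ 2 := by
      rw [two_mul_cubeAvg i]
      congr 1
      funext x
      simp only [fourierSum_insert hi, fourierSum_flipAt hi]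
      rw [show flipAt i x i = !x i by simp [flipAt], sgn_not, C_neg]
      generalize fourierSum I c x = f₀
      generalize fourierSum I e x = g₀
      generalize fourierSum I (fun S => c (insert i S)) x = f₁
      generalize fourierSum I (fun S => e (insert i S)) x = g₁
      linear_combination (2 * (f₀ * g₁) ^ 2 + 2 * (f₁ * g₀) ^ 2 + 8 * f₀ * f₁ * g₀ * g₁ +
        2 * f₁ ^ 2 * g₁ ^ 2 * (C (sgn (x i)) ^ 2 + 1)) * C_sgn_sq (σ := σ) (x i)
    simp only [cubeAvg_add, cubeAvg_sub, cubeAvg_mul_left] at havg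
    have hsq : SosProofGe A 4 (cubeAvg fun x =>
        (fourierSum I c x * fourierSum I (fun S => e (insert i S)) x -
          fourierSum I (fun S => c (insert i S)) x * fourierSum I e x) ^ 2) :=
      SosProofGe.cubeAvg fun x => sosProofGe_sq (d := 2) <| (totalDegree_sub _ _).trans <| max_le
        ((totalDegree_mul _ _).trans <| add_le_add (totalDegree_fourierSum_le hc I x)
          (totalDegree_fourierSum_le he' I x))
        ((totalDegree_mul _ _).trans <| add_le_add (totalDegree_fourierSum_le hc' I x)
          (totalDegree_fourierSum_le he I x))
    have key := ((((ih hc he).add (ih hc' he')).add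
      (((ih hc he').add (ih hc' he)).C_mul (r := 3) (by norm_num))).add
      (((hpos hc').mul (hpos he')).C_mul (r := 8) (by norm_num))).add
      (hsq.C_mul (r := 2) (by norm_num))
    convert key using 1
    refine eq_of_two_mul_eq ?_
    rw [hsplit, hsplit, mul_sub, havg]
    simp only [map_ofNat]
    ring

lemma fhatP_totalDegree_le (S : Finset (Fin n)) : (fhatP S).totalDegree ≤ 1 := by
  refine (totalDegree_mul _ _).trans ?_
  rw [totalDegree_C, zero_add]
  refine totalDegree_finsetSum_le fun x _ => (totalDegree_mul _ _).trans ?_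
  rw [totalDegree_C, totalDegree_X]

lemma isUnitValued_X (x : Fin n → Bool) : IsUnitValued (cubeConstraints n) (X x) where
  totalDegree_le := (totalDegree_X _).le
  nonneg := sosProofGe_of_mem ⟨x, .inl rfl⟩ (totalDegree_X _).le
  le_one := sosProofGe_of_mem ⟨x, .inr rfl⟩ <| (totalDegree_sub _ _).trans <| by simp

/-- **Bessel's inequality** for the indeterminate function. -/
lemma sosProofGe_one_sub_sum_fhatP_sq :
    SosProofGe (cubeConstraints n) 2 (1 - ∑ S : Finset (Fin n), fhatP S ^ 2) := by
  have h₁ : SosProofGe (cubeConstraints n) 2 (cubeAvg fun x => 1 - X x ^ 2) :=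
    SosProofGe.cubeAvg fun x => by
      have hx := isUnitValued_X x
      convert (hx.le_one.mono one_le_two).add (hx.nonneg.mul hx.le_one) using 1
      ring
  have h₂ : SosProofGe (cubeConstraints n) 2
      (cubeAvg fun x => (X x - fourierSum Finset.univ fhatP x) ^ 2) :=
    SosProofGe.cubeAvg fun x => sosProofGe_sq (d := 1) <| (totalDegree_sub _ _).trans <|
      max_le (totalDegree_X _).le (totalDegree_fourierSum_le fhatP_totalDegree_le _ x)
  have h₃ : cubeAvg (fun x => fourierSum Finset.univ fhatP x * (X x : MvPolynomial _ ℝ)) =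
      ∑ S : Finset (Fin n), fhatP S ^ 2 := by
    have : ∀ x : Fin n → Bool, fourierSum Finset.univ fhatP x * (X x : MvPolynomial _ ℝ) =
        ∑ S : Finset (Fin n), fhatP S * (C (chi S x) * X x) := fun x => by
      rw [fourierSum, Finset.powerset_univ, Finset.sum_mul]
      exact Finset.sum_congr rfl fun S _ => by ring
    simp only [this]
    rw [cubeAvg_sum]
    refine Finset.sum_congr rfl fun S _ => ?_
    rw [cubeAvg_mul_left, sq]
    rfl
  convert h₁.add h₂ using 1
  rw [← cubeAvg_add]
  have : ∀ x : Fin n → Bool, (1 : MvPolynomial _ ℝ) - X x ^ 2 +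
      (X x - fourierSum Finset.univ fhatP x) ^ 2 = 1 -
      2 * (fourierSum Finset.univ fhatP x * X x) + fourierSum Finset.univ fhatP x ^ 2 :=
    fun x => by ring
  simp only [this, cubeAvg_add, cubeAvg_sub, cubeAvg_const, cubeAvg_mul_left]
  rw [h₃, cubeAvg_fourierSum_sq, Finset.powerset_univ]
  ring

end Fourier

section Smoothing

variable {n : ℕ}

/-- The indeterminate function after applying the noise operator with parameter `s`. -/
def noiseP (s : ℝ) (x : Fin n → Bool) : MvPolynomial (Fin n → Bool) ℝ :=
  fourierSum Finset.univ (fun S => C (s ^ S.card) * fhatP S) x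

lemma corrWeight_eq_sum_chi (s : ℝ) (x y : Fin n → Bool) : 2 ^ n * corrWeight s x y =
    ((2 : ℝ) ^ n)⁻¹ * ∑ S : Finset (Fin n), s ^ S.card * chi S x * chi S y := by
  have h : ∏ i, (1 + s * sgn (x i) * sgn (y i)) =
      ∑ S : Finset (Fin n), s ^ S.card * chi S x * chi S y := by
    rw [Finset.prod_one_add, Finset.powerset_univ]
    refine Finset.sum_congr rfl fun S _ => ?_
    rw [Finset.prod_mul_distrib, Finset.prod_mul_distrib, Finset.prod_const, chi, chi]
  rw [← h, corrWeight, Finset.prod_div_distrib, Finset.prod_const, Finset.card_univ,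
    Fintype.card_fin, show (4 : ℝ) = 2 * 2 by norm_num, mul_pow]
  field_simp

lemma noiseP_eq_sum (s : ℝ) (x : Fin n → Bool) :
    noiseP s x = ∑ y, C (2 ^ n * corrWeight s x y) * X y := by
  simp only [corrWeight_eq_sum_chi, noiseP, fourierSum, fhatP, Finset.mul_sum, map_sum,
    Finset.sum_mul, Finset.powerset_univ]
  rw [Finset.sum_comm]
  refine Finset.sum_congr rfl fun y _ => Finset.sum_congr rfl fun S _ => ?_
  simp only [C_mul]
  ring

lemma isUnitValued_noiseP {s : ℝ} (hs : |s| ≤ 1) (x : Fin n → Bool) :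
    IsUnitValued (cubeConstraints n) (noiseP s x) := by
  rw [noiseP_eq_sum]
  exact IsUnitValued.sum (fun y _ => mul_nonneg (by positivity) (corrWeight_nonneg hs x y))
    (sum_corrWeight s x) fun y _ => isUnitValued_X y

/-- Stability after noise: the noise parameter multiplies the correlation by `s ^ 2`. -/
lemma sum_corrWeight_mul_noiseP (ρ s : ℝ) : ∑ x : Fin n → Bool, ∑ y, C (corrWeight ρ x y) *
    (1 - noiseP s x - noiseP s y + 2 * noiseP s x * noiseP s y) = stabP (ρ * s ^ 2) := by
  have hL : ∀ x y : Fin n → Bool, 1 - noiseP s x - noiseP s y + 2 * noiseP s x * noiseP s y =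
      ∑ u, ∑ v, C (2 ^ n * corrWeight s x u * (2 ^ n * corrWeight s y v)) *
        (X u * X v + (1 - X u) * (1 - X v)) := fun x y => by
    have h1 : ∀ z : Fin n → Bool, ∑ u, C (2 ^ n * corrWeight s z u) =
        (1 : MvPolynomial (Fin n → Bool) ℝ) := fun z => by
      rw [← map_sum, sum_corrWeight, C_1]
    have e : ∀ u v : Fin n → Bool, C (2 ^ n * corrWeight s x u * (2 ^ n * corrWeight s y v)) *
        (X u * X v + (1 - X u) * (1 - X v)) =
        C (2 ^ n * corrWeight s x u) * C (2 ^ n * corrWeight s y v) -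
        (C (2 ^ n * corrWeight s x u) * X u) * C (2 ^ n * corrWeight s y v) -
        C (2 ^ n * corrWeight s x u) * (C (2 ^ n * corrWeight s y v) * X v) +
        (2 * (C (2 ^ n * corrWeight s x u) * X u)) *
          (C (2 ^ n * corrWeight s y v) * X v : MvPolynomial (Fin n → Bool) ℝ) := fun u v => by
      rw [C_mul]
      ring
    simp only [e, Finset.sum_add_distrib, Finset.sum_sub_distrib, ← Finset.mul_sum,
      ← Finset.sum_mul, h1, ← noiseP_eq_sum]
    ring
  have hW : ∀ u v : Fin n → Bool, ∑ x, ∑ y, corrWeight ρ x y *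
      (2 ^ n * corrWeight s x u * (2 ^ n * corrWeight s y v)) = corrWeight (ρ * s ^ 2) u v :=
    fun u v => by
      rw [show ρ * s ^ 2 = s * (ρ * s) by ring, ← sum_corrWeight_mul]
      refine Finset.sum_congr rfl fun x _ => ?_
      rw [← sum_corrWeight_mul ρ s x v, Finset.mul_sum]
      refine Finset.sum_congr rfl fun y _ => ?_
      rw [corrWeight_comm s u x]
      ring
  have hcomm : ∀ F : (Fin n → Bool) → (Fin n → Bool) → (Fin n → Bool) → (Fin n → Bool) →
      MvPolynomial (Fin n → Bool) ℝ, ∑ x, ∑ y, ∑ u, ∑ v, F x y u v =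
        ∑ u, ∑ v, ∑ x, ∑ y, F x y u v := fun F => by
    simpa only [Fintype.sum_prod_type] using Finset.sum_comm (s := Finset.univ) (t := Finset.univ)
      (f := fun (p q : (Fin n → Bool) × (Fin n → Bool)) => F p.1 p.2 q.1 q.2)
  simp only [hL, stabP, ← hW, map_sum, Finset.sum_mul, Finset.mul_sum]
  refine (hcomm _).trans <| Finset.sum_congr rfl fun u _ => Finset.sum_congr rfl fun v _ =>
    Finset.sum_congr rfl fun x _ => Finset.sum_congr rfl fun y _ => ?_
  simp only [C_mul]
  ring

/-- The coefficients of the noisy function at the sets that contain `i` and have size in `s`. -/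
def edgeCoeff (s : ℝ) (i : Fin n) (p : ℕ → Prop) [DecidablePred p] (S : Finset (Fin n)) :
    MvPolynomial (Fin n → Bool) ℝ :=
  if i ∈ S ∧ p S.card then C (s ^ S.card) * fhatP S else 0

lemma totalDegree_edgeCoeff_le (s : ℝ) (i : Fin n) (p : ℕ → Prop) [DecidablePred p]
    (S : Finset (Fin n)) : (edgeCoeff s i p S).totalDegree ≤ 1 := by
  unfold edgeCoeff
  split_ifs
  · refine (totalDegree_mul _ _).trans ?_
    rw [totalDegree_C, zero_add]
    exact fhatP_totalDegree_le S
  · simp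

lemma edgeDiff_noiseP (s : ℝ) (d : ℕ) (i : Fin n) (x : Fin n → Bool) : edgeDiff i (noiseP s) x =
    fourierSum Finset.univ (edgeCoeff s i (· ≤ d)) x +
      fourierSum Finset.univ (edgeCoeff s i (d < ·)) x := by
  simp only [edgeDiff, noiseP, fourierSum]
  rw [← Finset.sum_sub_distrib, Finset.mul_sum, ← Finset.sum_add_distrib]
  refine Finset.sum_congr rfl fun S _ => ?_
  have e2 : (C (1 / 2) * 2 : MvPolynomial (Fin n → Bool) ℝ) = 1 := by
    rw [← map_ofNat C 2, ← map_mul]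
    norm_num
  by_cases hi : i ∈ S
  · rw [chi_flipAt_of_mem hi, C_neg]
    rcases le_or_gt S.card d with h | h
    · simp only [edgeCoeff, hi, h, not_lt.2 h, true_and, if_true, if_false]
      linear_combination C (chi S x) * (C (s ^ S.card) * fhatP S) * e2
    · simp only [edgeCoeff, hi, h, not_le.2 h, true_and, if_true, if_false]
      linear_combination C (chi S x) * (C (s ^ S.card) * fhatP S) * e2
  · rw [chi_flipAt_of_notMem hi]
    simp [edgeCoeff, hi]

/-- Low-degree edge differences are controlled by the low-degree influences. -/
lemma sosProofGe_lowInfP_sq_sub {s : ℝ} (hs : |s| ≤ 1) (d : ℕ) (i : Fin n) :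
    SosProofGe (cubeConstraints n) 4 (C (9 ^ d) * lowInfP d i ^ 2 -
      cubeAvg fun x => fourierSum Finset.univ (edgeCoeff s i (· ≤ d)) x ^ 4) := by
  set B : MvPolynomial (Fin n → Bool) ℝ :=
    ∑ S ∈ Finset.univ.powerset, C (3 ^ S.card) * edgeCoeff s i (· ≤ d) S ^ 2 with hB
  have hBpos : SosProofGe (cubeConstraints n) 2 B :=
    sosProofGe_sum_C_mul_sq (totalDegree_edgeCoeff_le s i _) _ fun S _ => by positivity
  have hD : SosProofGe (cubeConstraints n) 2 (C (3 ^ d) * lowInfP d i - B) := by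
    have e : C (3 ^ d) * lowInfP d i - B = ∑ S ∈ Finset.univ.powerset.filter
        (fun S => i ∈ S ∧ S.card ≤ d), C (3 ^ d - 3 ^ S.card * (s ^ S.card) ^ 2) * fhatP S ^ 2 := by
      simp only [C_sub, C_mul, C_pow, sub_mul, Finset.sum_sub_distrib, hB, lowInfP, edgeCoeff,
        ite_pow, mul_ite, Finset.mul_sum]
      congr 1
      rw [Finset.sum_filter]
      refine Finset.sum_congr rfl fun S _ => ?_
      split_ifs <;> ring
    rw [e]
    refine sosProofGe_sum_C_mul_sq fhatP_totalDegree_le _ fun S hS => ?_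
    have h1 : (s ^ S.card) ^ 2 ≤ 1 := by
      rw [← pow_mul, mul_comm, pow_mul, ← sq_abs]
      exact pow_le_one₀ (by positivity) (pow_le_one₀ (abs_nonneg s) hs)
    have h2 : (3 : ℝ) ^ S.card ≤ 3 ^ d :=
      pow_le_pow_right₀ (by norm_num) (Finset.mem_filter.1 hS).2.2
    have h3 : (0 : ℝ) < 3 ^ S.card := by positivity
    nlinarith
  have h := sosProofGe_hypercontractive (A := cubeConstraints n) Finset.univ
    (totalDegree_edgeCoeff_le s i (· ≤ d)) (totalDegree_edgeCoeff_le s i (· ≤ d))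
  rw [← hB] at h
  convert (h.add (hD.mul hD)).add ((hBpos.mul hD).C_mul zero_le_two) using 1
  have e : ∀ x, (fourierSum Finset.univ (edgeCoeff s i (· ≤ d)) x *
      fourierSum Finset.univ (edgeCoeff s i (· ≤ d)) x) ^ 2 =
      fourierSum Finset.univ (edgeCoeff s i (· ≤ d)) x ^ 4 := fun x => by ring
  simp only [e]
  rw [show (9 : ℝ) ^ d = (3 ^ d) ^ 2 by rw [← pow_mul, mul_comm, pow_mul]; norm_num, C_pow,
    map_ofNat]
  ring

/-- High-degree edge differences are negligible. -/
lemma sosProofGe_sub_sum_high {s δ : ℝ} {d : ℕ} (hδ0 : 0 ≤ δ)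
    (hδ : ∀ k : ℕ, d < k → k * (s ^ k) ^ 2 ≤ δ) :
    SosProofGe (cubeConstraints n) 2 (C δ - ∑ i : Fin n,
      cubeAvg fun x => fourierSum Finset.univ (edgeCoeff s i (d < ·)) x ^ 2) := by
  have e : ∑ i : Fin n, cubeAvg (fun x => fourierSum Finset.univ (edgeCoeff s i (d < ·)) x ^ 2) =
      ∑ S : Finset (Fin n), C (if d < S.card then S.card * (s ^ S.card) ^ 2 else 0) *
        fhatP S ^ 2 := by
    simp only [cubeAvg_fourierSum_sq, Finset.powerset_univ]
    rw [Finset.sum_comm]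
    refine Finset.sum_congr rfl fun S _ => ?_
    by_cases h : d < S.card
    · simp only [edgeCoeff, h, and_true, ite_pow, if_true]
      rw [zero_pow two_ne_zero, Finset.sum_ite_mem, Finset.univ_inter, Finset.sum_const,
        nsmul_eq_mul]
      simp only [C_mul, C_pow, map_natCast]
      ring
    · simp [edgeCoeff, h]
  rw [e]
  convert (sosProofGe_one_sub_sum_fhatP_sq.C_mul hδ0).add (sosProofGe_sum_C_mul_sq
    (A := cubeConstraints n) fhatP_totalDegree_le Finset.univ
    (w := fun S => δ - if d < S.card then S.card * (s ^ S.card) ^ 2 else 0) fun S _ => ?_) using 1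
  · simp only [C_sub, sub_mul, Finset.sum_sub_distrib, ← Finset.mul_sum]
    ring
  · split_ifs with h
    · exact sub_nonneg.2 (hδ _ h)
    · simpa

/-- The fourth moments of the edge differences of the noisy function. -/
lemma sosProofGe_sub_sum_edgeDiff {s δ : ℝ} {d : ℕ} (hs : |s| ≤ 1) (hδ0 : 0 ≤ δ)
    (hδ : ∀ k : ℕ, d < k → k * (s ^ k) ^ 2 ≤ δ) :
    SosProofGe (cubeConstraints n) 4 (C (4 * 9 ^ d) * ∑ i : Fin n, lowInfP d i ^ 2 + C (4 * δ) -
      ∑ i : Fin n, cubeAvg fun x => edgeDiff i (noiseP s) x ^ 4) := by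
  have h₁ := (SosProofGe.sum Finset.univ fun (i : Fin n) _ =>
    sosProofGe_lowInfP_sq_sub hs d i).C_mul (r := 4) (by norm_num)
  have h₂ := ((sosProofGe_sub_sum_high (n := n) hδ0 hδ).C_mul (r := 4) (by norm_num)).mono
    (show 2 ≤ 4 by norm_num)
  have h₃ : SosProofGe (cubeConstraints n) 4 (∑ i : Fin n, cubeAvg fun x =>
      C 4 * fourierSum Finset.univ (edgeCoeff s i (· ≤ d)) x ^ 4 +
      C 4 * fourierSum Finset.univ (edgeCoeff s i (d < ·)) x ^ 2 -
      edgeDiff i (noiseP s) x ^ 4) := by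
    refine SosProofGe.sum _ fun i _ => SosProofGe.cubeAvg fun x => ?_
    have hl := totalDegree_fourierSum_le (totalDegree_edgeCoeff_le s i (· ≤ d)) Finset.univ x
    have hh := totalDegree_fourierSum_le (totalDegree_edgeCoeff_le s i (d < ·)) Finset.univ x
    have ha : SosProofGe (cubeConstraints n) 2 (1 - edgeDiff i (noiseP s) x ^ 2) := by
      have g₁ := isUnitValued_noiseP hs x
      have g₂ := isUnitValued_noiseP hs (flipAt i x)
      have h1 : SosProofGe (cubeConstraints n) 1 1 := by simpa using sosProofGe_C zero_le_one
      convert ((((g₁.le_one.add g₂.nonneg).add h1).C_mul (r := 1 / 2) (by norm_num)).mul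
        (((g₂.le_one.add g₁.nonneg).add h1).C_mul (r := 1 / 2) (by norm_num))) using 1
      have e2 : (C (1 / 2) * 2 : MvPolynomial (Fin n → Bool) ℝ) = 1 := by
        rw [← map_ofNat C 2, ← map_mul]
        norm_num
      rw [edgeDiff]
      linear_combination (-(C (1 / 2) * 2) - 1) * e2
    rw [edgeDiff_noiseP s d] at ha ⊢
    generalize fourierSum Finset.univ (edgeCoeff s i (· ≤ d)) x = l at *
    generalize fourierSum Finset.univ (edgeCoeff s i (d < ·)) x = h at *
    have hlh : (l + h).totalDegree ≤ 1 := (totalDegree_add _ _).trans (max_le hl hh)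
    have k₁ : SosProofGe (cubeConstraints n) 4 (((l + h) * (l - h)) ^ 2) :=
      sosProofGe_sq (d := 2) <| (totalDegree_mul _ _).trans <|
        add_le_add hlh ((totalDegree_sub _ _).trans (max_le hl hh))
    have k₂ := (sosProofGe_sq (A := cubeConstraints n) hh).mul ha
    have k₃ : SosProofGe (cubeConstraints n) 4 (((l + h) ^ 2 - 2 * l ^ 2) ^ 2) := by
      refine sosProofGe_sq (d := 2) <| (totalDegree_sub _ _).trans <| max_le
        ((totalDegree_pow _ 2).trans (by lia)) ((totalDegree_mul _ _).trans ?_)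
      rw [← map_ofNat C 2, totalDegree_C, zero_add]
      exact (totalDegree_pow _ 2).trans (by lia)
    convert ((k₁.C_mul (r := 2) (by norm_num)).add (k₂.C_mul (r := 4) (by norm_num))).add k₃
      using 1
    simp only [map_ofNat]
    ring
  convert (h₁.add h₂).add h₃ using 1
  simp only [cubeAvg_add, cubeAvg_sub, cubeAvg_mul_left, Finset.sum_add_distrib,
    Finset.sum_sub_distrib, ← Finset.mul_sum, C_mul]
  ring

end Smoothing

/-- A perturbation of the correlation compensated by a noise parameter less than `1`. -/
lemma exists_perturbation {κ ρ : ℝ} (hκ : 0 < κ) (hρ0 : -1 < ρ) (hρ1 : ρ < 0) :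
    ∃ β τ s : ℝ, -(Real.pi / 2) < β ∧ β < 0 ∧ Real.arcsin ρ - Real.pi * (κ / 4) ≤ β ∧
      τ ^ 2 < Real.sin β ^ 2 ∧ 0 < s ∧ s < 1 ∧ τ * s ^ 2 = ρ := by
  have hπ := Real.pi_pos
  set α := Real.arcsin ρ with hα
  have hα0 : α < 0 := Real.arcsin_lt_zero.2 hρ1
  have hα1 : -(Real.pi / 2) < α := Real.neg_pi_div_two_lt_arcsin.2 hρ0
  have hm : max (-(Real.pi / 2)) (α - Real.pi * κ / 2) < α :=
    max_lt hα1 (by have := mul_pos hπ hκ; linarith)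
  set m := max (-(Real.pi / 2)) (α - Real.pi * κ / 2) with hm'
  have hm1 : -(Real.pi / 2) ≤ m := le_max_left _ _
  have hm2 : α - Real.pi * κ / 2 ≤ m := le_max_right _ _
  have hsin : Real.sin ((α + m) / 2) < ρ := by
    rw [← Real.sin_arcsin hρ0.le (by linarith : ρ ≤ 1), ← hα]
    exact Real.sin_lt_sin_of_lt_of_le_pi_div_two (by linarith) (by linarith) (by linarith)
  set u := Real.sin ((α + m) / 2) with hu
  have hq0 : 0 < ρ / u := div_pos_of_neg_of_neg hρ1 (by linarith)
  have hq1 : ρ / u < 1 := (div_lt_one_of_neg (by linarith)).2 hsin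
  have ht : 0 < (ρ / u + 1) / 2 := by linarith
  refine ⟨(α + m) / 2, ρ / ((ρ / u + 1) / 2), √((ρ / u + 1) / 2), by linarith, by linarith,
    by linarith, ?_, Real.sqrt_pos.2 ht, ?_, ?_⟩
  · rw [← hu, sq_lt_sq, abs_div, abs_of_pos ht, div_lt_iff₀ ht, abs_of_neg hρ1,
      abs_of_neg (by linarith : u < 0)]
    have : ρ / u * u = ρ := div_mul_cancel₀ _ (by linarith)
    nlinarith
  · rw [Real.sqrt_lt' one_pos]
    linarith
  · rw [Real.sq_sqrt ht.le, div_mul_cancel₀ _ ht.ne']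

lemma exists_forall_mul_pow_sq_le {s δ : ℝ} (hs0 : 0 < s) (hs1 : s < 1) (hδ : 0 < δ) :
    ∃ d : ℕ, ∀ k : ℕ, d < k → k * (s ^ k) ^ 2 ≤ δ := by
  have h := tendsto_self_mul_const_pow_of_lt_one (sq_nonneg s) (by nlinarith : s ^ 2 < 1)
  obtain ⟨d, hd⟩ := Filter.eventually_atTop.1 (h.eventually_le_const hδ)
  refine ⟨d, fun k hk => ?_⟩
  rw [← pow_mul, mul_comm k, pow_mul]
  exact hd k hk.le

/-- **SoS version of Majority is Stablest** (Theorem 6.1): a degree-`d₀` SoS proof from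
`A_p` of `E_{x, y∼_ρ x}[f(x)f(y) + (1-f(x))(1-f(y))] ≥ 1 - arccos ρ/π - κ - c Σ_i (Inf_i^{≤d₁} f)²`,
i.e. of the nonnegativity of the difference of the two sides. -/
theorem sos_majority_is_stablest (κ : ℝ) (hκ : 0 < κ) (ρ : ℝ) (hρ0 : -1 < ρ) (hρ1 : ρ < 0) :
    ∃ (d₀ d₁ : ℕ) (c : ℝ), 0 < c ∧ ∀ n : ℕ,
      SosProofGe (cubeConstraints n) d₀
        (stabP ρ - C (1 - Real.arccos ρ / Real.pi - κ) +
          C c * ∑ i : Fin n, lowInfP d₁ i ^ 2) := by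
  obtain ⟨β, τ, s, hβ0, hβ1, hβα, hτ, hs0, hs1, hτs⟩ := exists_perturbation hκ hρ0 hρ1
  have hτ1 : |τ| ≤ 1 := by
    rw [← sq_le_one_iff_abs_le_one]
    exact hτ.le.trans (Real.sin_sq_le_one β)
  have hs : |s| ≤ 1 := abs_le.2 ⟨by linarith, hs1.le⟩
  obtain ⟨M, b, hb⟩ := exists_isGridProfile hβ0 hβ1 hτ (show 0 < κ / 4 by positivity)
  obtain ⟨D₁, K, hK, h₁⟩ := exists_sosProofGe_bernstein₂_average hb
  obtain ⟨D₂, h₂⟩ := exists_sosProofGe_sub_bernstein₂ hb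
  obtain ⟨D₃, h₃⟩ := exists_sosProofGe_bernstein₂_self_sub hb
  have hδ : 0 < κ / (32 * (K + 1)) := by positivity
  have hKδ : 8 * K * (κ / (32 * (K + 1))) ≤ κ / 4 := by
    rw [← mul_div_assoc, div_le_iff₀ (by positivity)]
    nlinarith
  set δ := κ / (32 * (K + 1))
  obtain ⟨d₁, hd₁⟩ := exists_forall_mul_pow_sq_le hs0 hs1 hδ
  obtain ⟨d, hd, hD₁, hD₂, hD₃⟩ : ∃ d, 4 ≤ d ∧ D₁ ≤ d ∧ D₂ ≤ d ∧ D₃ ≤ d :=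
    ⟨4 + D₁ + D₂ + D₃, by lia, by lia, by lia, by lia⟩
  refine ⟨d, d₁, 2 * K * (4 * 9 ^ d₁) + 1, by positivity, fun n => ?_⟩
  have hg : ∀ x : Fin n → Bool, IsUnitValued (cubeConstraints n) (noiseP s x) :=
    isUnitValued_noiseP hs
  have p₁ : SosProofGe (cubeConstraints n) d (∑ x : Fin n → Bool, ∑ y, C (corrWeight τ x y) *
      (1 - noiseP s x - noiseP s y + 2 * noiseP s x * noiseP s y -
        bernstein₂ (M + 2) b (noiseP s x) (noiseP s y) + C (κ / 4))) :=
    SosProofGe.sum _ fun x _ => SosProofGe.sum _ fun y _ =>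
      ((h₂ (hg x) (hg y)).mono hD₂).C_mul (corrWeight_nonneg hτ1 x y)
  have p₂ := sosProofGe_corr_tensor hτ1 hK hd
    (fun ha hb hx hx' hy hy' => (h₁ ha hb hx hx' hy hy').mono hD₁) hg hg
  have p₃ := (h₃ (IsUnitValued.cubeAvg hg)).mono hD₃
  have p₄ := ((sosProofGe_sub_sum_edgeDiff (n := n) hs hδ.le hd₁).mono hd).C_mul
    (r := 2 * K) (by positivity)
  have p₅ : SosProofGe (cubeConstraints n) d (∑ i : Fin n, lowInfP d₁ i ^ 2) := by
    refine SosProofGe.sum _ fun i _ => (sosProofGe_sq (d := 2) ?_).mono hd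
    exact totalDegree_finsetSum_le fun S _ => (totalDegree_pow _ 2).trans
      (by have := fhatP_totalDegree_le S; lia)
  have hconst : 0 ≤ 1 / 2 + β / Real.pi - κ / 4 - κ / 4 - 2 * K * (4 * δ) -
      (1 - Real.arccos ρ / Real.pi - κ) := by
    have h : Real.arcsin ρ / Real.pi - κ / 4 ≤ β / Real.pi := by
      rw [le_div_iff₀ Real.pi_pos, sub_mul, div_mul_cancel₀ _ Real.pi_ne_zero]
      linarith
    rw [Real.arccos, sub_div, div_right_comm, div_self Real.pi_ne_zero]
    linarith
  have p₆ : SosProofGe (cubeConstraints n) d _ := sosProofGe_C hconst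
  convert ((((p₁.add p₂).add p₃).add p₄).add p₅).add p₆ using 1
  have hsum : ∑ x : Fin n → Bool, ∑ y, C (corrWeight τ x y) * C (κ / 4) =
      (C (κ / 4) : MvPolynomial (Fin n → Bool) ℝ) := by
    simp only [← Finset.sum_mul, ← map_sum]
    rw [sum_sum_corrWeight, C_1, one_mul]
  rw [← hτs, ← sum_corrWeight_mul_noiseP, hτs]
  simp only [mul_add (C (corrWeight τ _ _)), mul_sub (C (corrWeight τ _ _)),
    Finset.sum_add_distrib, Finset.sum_sub_distrib, hsum, C_add, C_sub, C_mul, C_1, map_ofNat]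
  ring

end DMN
end
end
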